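/- Let φ: ℝ^n × ℝ^m → ℝ^m and G: ℝ^n × ℝ^m → ℝ^p be continuously differentiable, g: ℝ^m → ℝ^q twice continuously differentiable, Γ := {y | g(y) ≤ 0}, and let (x̄, ȳ) satisfy 0 ∈ φ(x̄,ȳ) + N̂_Γ(ȳ) and G(x̄,ȳ) ≤ 0. Assume: (i) the metric subregularity constraint qualification holds for the system g(y) ≤ 0 at ȳ and for the system G(x,y) ≤ 0 at (x̄,ȳ); (ii) ∇_x G(x̄,ȳ)^T η = 0 with η ∈ N_{ℝ^p_-}(G(x̄,ȳ)) implies ∇_y G(x̄,ȳ)^T η = 0; and (iii) there do not exist (u,v) ≠ 0, λ ∈ Λ(ȳ, −φ(x̄,ȳ); v) ∩ E(ȳ, −φ(x̄,ȳ)), η ∈ ℝ^p_+, and w ≠ 0 satisfying (a) ∇G(x̄,ȳ)(u,v) ∈ T_{ℝ^p_-}(G(x̄,ȳ)), (b) (v, −∇_x φ(x̄,ȳ)u − ∇_y φ(x̄,ȳ)v) ∈ T_{gph N̂_Γ}(ȳ, −φ(x̄,ȳ)), (c) −∇_x φ(x̄,ȳ)^T w + ∇_x G(x̄,ȳ)^T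 η = 0, η ∈ N_{ℝ^p_-}(G(x̄,ȳ)), η^T ∇G(x̄,ȳ)(u,v) = 0, and (d) ∇g_i(ȳ)w = 0 for all i ∈ I^+(λ) and w^T(∇_y φ(x̄,ȳ) + ∇²(λ^T g)(ȳ))w − η^T ∇_y G(x̄,ȳ)w ≤ 0. Then the set-valued map M_MPEC(x,y) := (φ(x,y) + N̂_Γ(y)) × (G(x,y) − ℝ^p_-) is metrically subregular at ((x̄,ȳ), 0). -/

import Mathlib

open Filter Topology Set
open scoped RealInnerProductSpace

noncomputable section

/-- `ℝ^d` as a Euclidean space. -/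
abbrev Eu (d : ℕ) := EuclideanSpace ℝ (Fin d)

/-- The (Bouligand–Severi) tangent/contingent cone to `Ω` at `z`. -/
def tcone {E : Type*} [NormedAddCommGroup E] [NormedSpace ℝ E] (Ω : Set E) (z : E) : Set E :=
  {u | ∃ t : ℕ → ℝ, ∃ w : ℕ → E, (∀ k, 0 < t k) ∧
    Tendsto t atTop (𝓝 0) ∧ Tendsto w atTop (𝓝 u) ∧ ∀ k, z + t k • w k ∈ Ω}

/-- The (Fréchet) regular normal cone to `Ω` at `zb`. -/
def rnc {E : Type*} [NormedAddCommGroup E] [InnerProductSpace ℝ E]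
    (Ω : Set E) (zb : E) : Set E :=
  {v | ∀ ε > (0 : ℝ), ∃ δ > (0 : ℝ), ∀ z ∈ Ω, ‖z - zb‖ < δ →
    ⟪v, z - zb⟫ ≤ ε * ‖z - zb‖}

/-- Metric subregularity of a set-valued map at a point of its graph. -/
def msr {E F : Type*} [NormedAddCommGroup E] [NormedAddCommGroup F]
    (M : E → Set F) (zb : E) (wb : F) : Prop :=
  ∃ κ : ℝ, 0 < κ ∧ ∃ W ∈ 𝓝 zb, ∀ z ∈ W,
    EMetric.infEdist z {z' | wb ∈ M z'} ≤ ENNReal.ofReal κ * EMetric.infEdist wb (M z)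

/-- The lower-level feasible set `Γ = {y | g(y) ≤ 0}`. -/
def Gam {m q : ℕ} (g : Eu m → Eu q) : Set (Eu m) := {y | ∀ i, g y i ≤ 0}

/-- The multiplier set `Λ(y, y*) = {λ ≥ 0 | ∇g(y)ᵀλ = y*, λ_i = 0 for i ∉ I(y)}`. -/
def Lam {m q : ℕ} (g : Eu m → Eu q) (y ys : Eu m) : Set (Eu q) :=
  {l | (∀ i, 0 ≤ l i) ∧ ContinuousLinearMap.adjoint (fderiv ℝ g y) l = ys ∧
    ∀ i, g y i ≠ 0 → l i = 0}

/-- The critical cone `K(y, y*) = T_Γ(y) ∩ {y*}ᗮ`. -/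
def Kcone {m q : ℕ} (g : Eu m → Eu q) (y ys : Eu m) : Set (Eu m) :=
  tcone (Gam g) y ∩ {v | ⟪v, ys⟫ = 0}

/-- The convex-analysis normal cone to a (convex) set `Ω` at `z`. -/
def cnc {E : Type*} [NormedAddCommGroup E] [InnerProductSpace ℝ E]
    (Ω : Set E) (z : E) : Set E :=
  {w | ∀ z' ∈ Ω, ⟪w, z' - z⟫ ≤ 0}

/-- `∇²(λᵀg)(y) v`, the Hessian of `y ↦ ⟨λ, g(y)⟩` applied to `v`, realized as the
derivative at `y` of the gradient map `y' ↦ ∇g(y')ᵀλ` in the direction `v`. -/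
def hessA {m q : ℕ} (g : Eu m → Eu q) (l : Eu q) (y v : Eu m) : Eu m :=
  fderiv ℝ (fun y' => ContinuousLinearMap.adjoint (fderiv ℝ g y') l) y v

/-- The directional multiplier set
`Λ(y, y*; v) = argmax {vᵀ∇²(λᵀg)(y)v | λ ∈ Λ(y, y*)}`. -/
def dirLam {m q : ℕ} (g : Eu m → Eu q) (y ys v : Eu m) : Set (Eu q) :=
  {l | l ∈ Lam g y ys ∧ ∀ l' ∈ Lam g y ys, ⟪v, hessA g l' y v⟫ ≤ ⟪v, hessA g l y v⟫}

/-- The extreme points `E(y, y*)` of `Λ(y, y*)`: those multipliers `λ` for which the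
active gradients `{∇g_i(y) | λ_i > 0}` are linearly independent. -/
def ExtPts {m q : ℕ} (g : Eu m → Eu q) (y ys : Eu m) : Set (Eu q) :=
  {l | l ∈ Lam g y ys ∧
    LinearIndependent ℝ (fun i : {i : Fin q // 0 < l i} =>
      fderiv ℝ (fun y' => g y' i.1) y)}

/-- The graph of the regular normal cone map `y ↦ N̂_Γ(y)`. -/
def gphN {m q : ℕ} (g : Eu m → Eu q) : Set (Eu m × Eu m) :=
  {p | p.1 ∈ Gam g ∧ p.2 ∈ rnc (Gam g) p.1}

/-- MSCQ for the lower-level system `g(y) ≤ 0` at `yb`: metric subregularity of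
`y ↦ g(y) − ℝ^q₋` at `(yb, 0)`. -/
def MSCQlow {m q : ℕ} (g : Eu m → Eu q) (yb : Eu m) : Prop :=
  msr (fun y => {w : Eu q | ∀ i, g y i - w i ≤ 0}) yb 0

/-- Error bound extracted from metric subregularity of an inequality system. -/
theorem exists_near_feasible {E : Type*} [NormedAddCommGroup E] {r : ℕ} {F : E → Eu r} {zb : E}
    (h : msr (fun z => {w : Eu r | ∀ j, F z j - w j ≤ 0}) zb 0) :
    ∃ κ > (0 : ℝ), ∃ δ > (0 : ℝ), ∀ z, ‖z - zb‖ < δ →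
      ∃ z', (∀ j, F z' j ≤ 0) ∧ ‖z' - z‖ ≤ κ * ∑ j, max (F z j) 0 := by
  obtain ⟨κ, hκ, W, hW, h⟩ := h
  obtain ⟨δ, hδ, hball⟩ := Metric.mem_nhds_iff.1 hW
  refine ⟨2 * κ, by positivity, δ, hδ, fun z hz => ?_⟩
  have hnn : 0 ≤ ∑ j, max (F z j) 0 := Finset.sum_nonneg fun j _ => le_max_right _ _
  rcases hnn.eq_or_lt with h0 | hpos
  · refine ⟨z, fun j => ?_, by simp [← h0]⟩
    have := (Finset.sum_eq_zero_iff_of_nonneg fun j _ => le_max_right (F z j) 0).1 h0.symm j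
      (Finset.mem_univ _)
    exact (le_max_left _ _).trans this.le
  · have hz' := h z (hball (by simpa [dist_eq_norm] using hz))
    set w : Eu r := WithLp.toLp 2 fun j => max (F z j) 0 with hw
    have hwn : ‖w‖ ≤ ∑ j, max (F z j) 0 := by
      rw [EuclideanSpace.norm_eq, Real.sqrt_le_left hnn]
      refine (Finset.sum_le_sum fun j _ => ?_).trans
        (Finset.sum_sq_le_sq_sum_of_nonneg fun j _ => le_max_right (F z j) 0)
      simp [hw]
    have h2 : Metric.infEDist (0 : Eu r) {w : Eu r | ∀ j, F z j - w j ≤ 0} ≤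
        ENNReal.ofReal (∑ j, max (F z j) 0) := by
      refine (Metric.infEDist_le_edist_of_mem (y := w) ?_).trans ?_
      · intro j
        simp [hw]
      · rw [edist_dist, dist_zero_left]
        exact ENNReal.ofReal_le_ofReal hwn
    have h3 : Metric.infEDist z {z' | (0 : Eu r) ∈ {w : Eu r | ∀ j, F z' j - w j ≤ 0}} <
        ENNReal.ofReal (2 * κ * ∑ j, max (F z j) 0) := by
      refine (hz'.trans (mul_le_mul_right h2 _)).trans_lt ?_
      rw [← ENNReal.ofReal_mul hκ.le]
      refine (ENNReal.ofReal_lt_ofReal_iff (by positivity)).2 ?_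
      nlinarith [mul_pos hκ hpos]
    obtain ⟨z', hz'm, hz'd⟩ := Metric.infEDist_lt_iff.1 h3
    refine ⟨z', fun j => by simpa using hz'm j, ?_⟩
    rw [edist_dist, ENNReal.ofReal_lt_ofReal_iff (by positivity)] at hz'd
    rw [← dist_eq_norm, dist_comm]
    exact hz'd.le

/-- A multiplier rule: if an affine function is dominated by a penalty of the positive parts of an
affine system, then it is (up to the constant) represented by a bounded multiplier. -/
theorem exists_box_multiplier {E : Type*} [AddCommGroup E] [Module ℝ E] [FiniteDimensional ℝ E]
    {q : ℕ} (A : E →ₗ[ℝ] (Fin q → ℝ)) (a : Fin q → ℝ) (ℓ : E →ₗ[ℝ] ℝ) (c M : ℝ) (hM : 0 ≤ M)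
    (I : Finset (Fin q)) (h : ∀ d, ℓ d + c ≤ M * ∑ i ∈ I, max (A d i + a i) 0)
    (h0 : ∀ d, ℓ d ≤ M * ∑ i ∈ I, max (A d i) 0) :
    ∃ l : Fin q → ℝ, (∀ i, 0 ≤ l i ∧ l i ≤ M) ∧ (∀ i, i ∉ I → l i = 0) ∧
      (∀ d, ℓ d = ∑ i, l i * A d i) ∧ c ≤ ∑ i, l i * a i := by
  classical
  by_contra hcon
  push Not at hcon
  let b := Module.finBasis ℝ E
  let Φ : (Fin q → ℝ) →ₗ[ℝ] (Fin (Module.finrank ℝ E) → ℝ) × ℝ :=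
    { toFun := fun l => (fun k => ∑ i, l i * A (b k) i, ∑ i, l i * a i)
      map_add' := fun x y => by
        ext <;> simp [add_mul, Finset.sum_add_distrib]
      map_smul' := fun x y => by
        ext <;> simp [Finset.mul_sum, mul_assoc] }
  let B : Set (Fin q → ℝ) := Set.pi univ fun i => Icc 0 (if i ∈ I then M else 0)
  have hBc : IsCompact B := isCompact_univ_pi fun i => isCompact_Icc
  have hBv : Convex ℝ B := convex_pi fun i _ => convex_Icc _ _
  let R : Set ((Fin (Module.finrank ℝ E) → ℝ) × ℝ) := {p | p.1 = (fun k => ℓ (b k)) ∧ c ≤ p.2}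
  have hRc : IsClosed R :=
    (isClosed_eq continuous_fst continuous_const).inter
      (isClosed_le continuous_const continuous_snd)
  have hRv : Convex ℝ R := by
    intro p hp r hr s t hs ht hst
    refine ⟨?_, ?_⟩
    · change s • p.1 + t • r.1 = _
      rw [hp.1, hr.1, ← add_smul, hst, one_smul]
    · change c ≤ s * p.2 + t * r.2
      have h1 := mul_le_mul_of_nonneg_left hp.2 hs
      have h2 := mul_le_mul_of_nonneg_left hr.2 ht
      have : c = s * c + t * c := by rw [← add_mul, hst, one_mul]
      linarith
  have hbox : ∀ l ∈ B, (∀ i, 0 ≤ l i ∧ l i ≤ M) ∧ ∀ i, i ∉ I → l i = 0 := by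
    intro l hl
    refine ⟨fun i => ?_, fun i hi => ?_⟩
    · have := hl i (mem_univ _)
      refine ⟨this.1, this.2.trans ?_⟩
      split_ifs <;> simp [hM]
    · have := hl i (mem_univ _)
      simp only [if_neg hi] at this
      exact le_antisymm this.2 this.1
  have hdis : Disjoint (Φ '' B) R := by
    rw [Set.disjoint_left]
    rintro _ ⟨l, hl, rfl⟩ ⟨hR1, hR2⟩
    obtain ⟨hb1, hb2⟩ := hbox l hl
    refine absurd hR2 (not_le.2 (hcon l hb1 hb2 fun d => ?_))
    have hlin : ℓ = ∑ i, l i • (LinearMap.proj i ∘ₗ A) := by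
      refine b.ext fun k => ?_
      have := congrFun hR1 k
      simp only [Φ, LinearMap.coe_mk, AddHom.coe_mk] at this
      simp [← this]
    have := congrArg (fun f => f d) hlin
    simpa using this
  obtain ⟨f, u, v, hu, huv, hv⟩ := geometric_hahn_banach_compact_closed
    (hBv.linear_image Φ) (hBc.image (LinearMap.continuous_of_finiteDimensional Φ)) hRv hRc hdis
  set θ := f (0, 1) with hθ
  set d : E := ∑ k, f (Pi.single k 1, 0) • b k with hd
  have hf : ∀ (x : Fin (Module.finrank ℝ E) → ℝ) (s : ℝ),
      f (x, s) = ∑ k, x k * f (Pi.single k 1, 0) + s * θ := by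
    intro x s
    have h1 : (x, s) = ∑ k, x k • ((Pi.single k 1, 0) : (Fin (Module.finrank ℝ E) → ℝ) × ℝ)
        + s • (0, 1) := by
      ext i
      · simp [Prod.fst_sum, Finset.sum_apply, Pi.single_apply]
      · simp [Prod.snd_sum]
    rw [h1, map_add, map_sum, map_smul]
    simp only [map_smul, smul_eq_mul, hθ]
  have hfR : ∀ s, c ≤ s → v < ℓ d + s * θ := by
    intro s hs
    have := hv ((fun k => ℓ (b k)), s) ⟨rfl, hs⟩
    rw [hf] at this
    rw [hd, map_sum]
    simp only [map_smul, smul_eq_mul]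
    simpa only [mul_comm (ℓ _)] using this
  have hfB : ∀ l ∈ B, ∑ i, l i * (A d i + θ * a i) < u := by
    intro l hl
    have := hu _ ⟨l, hl, rfl⟩
    simp only [Φ, LinearMap.coe_mk, AddHom.coe_mk] at this
    rw [hf] at this
    convert this using 1
    rw [hd, map_sum]
    simp only [map_smul, Finset.sum_apply, Pi.smul_apply, smul_eq_mul, mul_add,
      Finset.sum_add_distrib, Finset.mul_sum, Finset.sum_mul]
    congr 1
    · rw [Finset.sum_comm]
      exact Finset.sum_congr rfl fun i _ => Finset.sum_congr rfl fun j _ => by ring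
    · exact Finset.sum_congr rfl fun i _ => by ring
  have hpen : M * ∑ i ∈ I, max (A d i + θ * a i) 0 < u := by
    have hl : (fun i => if i ∈ I ∧ 0 < A d i + θ * a i then M else 0) ∈ B := by
      intro i _
      dsimp only
      by_cases hi : i ∈ I
      · rw [if_pos hi]
        split_ifs <;> simp [hM]
      · rw [if_neg hi, if_neg fun h => hi h.1]
        simp
    have := hfB _ hl
    convert this using 1
    rw [Finset.mul_sum, ← Finset.sum_filter_add_sum_filter_not Finset.univ (· ∈ I)]
    rw [Finset.sum_eq_zero (s := Finset.univ.filter (¬ · ∈ I)), add_zero]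
    · rw [Finset.filter_mem_eq_inter, Finset.univ_inter]
      refine Finset.sum_congr rfl fun i hi => ?_
      by_cases hp : 0 < A d i + θ * a i
      · rw [if_pos ⟨hi, hp⟩, max_eq_left hp.le]
      · rw [if_neg (fun h => hp h.2), max_eq_right (not_lt.1 hp)]
        simp
    · intro i hi
      rw [if_neg (fun h => (Finset.mem_filter.1 hi).2 h.1), zero_mul]
  have hθ0 : 0 ≤ θ := by
    by_contra hneg
    push Not at hneg
    have h1 := hfR (max c ((v - ℓ d) / θ)) (le_max_left _ _)
    have h2 := mul_le_mul_of_nonpos_right (le_max_right c ((v - ℓ d) / θ)) hneg.le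
    rw [div_mul_cancel₀ _ hneg.ne] at h2
    linarith
  rcases hθ0.eq_or_lt with hz | hpos
  · have h1 := hfR c le_rfl
    rw [← hz] at h1 hpen
    simp only [zero_mul, add_zero, mul_zero] at h1 hpen
    linarith [h0 d]
  · have h1 := hfR c le_rfl
    have h2 := h (θ⁻¹ • d)
    have h3 : θ * (ℓ (θ⁻¹ • d) + c) = ℓ d + c * θ := by
      rw [map_smul, smul_eq_mul]; field_simp
    have h4 : θ * (M * ∑ i ∈ I, max (A (θ⁻¹ • d) i + a i) 0)
        = M * ∑ i ∈ I, max (A d i + θ * a i) 0 := by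
      rw [mul_left_comm, Finset.mul_sum]
      congr 1
      refine Finset.sum_congr rfl fun i _ => ?_
      rw [mul_max_of_nonneg _ _ hpos.le, map_smul, Pi.smul_apply, smul_eq_mul, mul_zero]
      congr 1
      field_simp
    have := mul_le_mul_of_nonneg_left h2 hpos.le
    rw [h3, h4] at this
    linarith

theorem inner_eq_sum {r : ℕ} (x y : Eu r) : ⟪x, y⟫ = ∑ i, x i * y i := by
  rw [PiLp.inner_apply]
  exact Finset.sum_congr rfl fun i _ => by simp [mul_comm]

/-- The total constraint violation along a curve approaching a feasible point is governed by the
active constraints. -/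
theorem eventually_sum_posPart_le {E ι : Type*} [TopologicalSpace E] {r : ℕ} {F : E → Eu r}
    {L : Filter ι} {c : ι → E} {p : ι → ℝ} {b : Fin r → ℝ} {z : E} (hc : Tendsto c L (𝓝 z))
    (hF : ContinuousAt F z) (hzF : ∀ j, F z j ≤ 0) (hp : ∀ᶠ t in L, 0 < p t)
    (hb : ∀ j, F z j = 0 → ∀ ε > (0 : ℝ), ∀ᶠ t in L, F (c t) j ≤ p t * (b j + ε))
    {ε : ℝ} (hε : 0 < ε) :
    ∀ᶠ t in L, ∑ j, max (F (c t) j) 0 ≤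
      p t * (∑ j with F z j = 0, max (b j) 0 + ε) := by
  classical
  have hε' : 0 < ε / (r + 1) := by positivity
  have key : ∀ j, ∀ᶠ t in L, max (F (c t) j) 0 ≤
      p t * ((if F z j = 0 then max (b j) 0 else 0) + ε / (r + 1)) := by
    intro j
    by_cases hj : F z j = 0
    · filter_upwards [hp, hb j hj _ hε'] with t ht1 ht2
      rw [if_pos hj]
      refine max_le (ht2.trans ?_) ?_
      · gcongr
        exact le_max_left _ _
      · have := le_max_right (b j) 0
        positivity
    · have hlt : F z j < 0 := lt_of_le_of_ne (hzF j) hj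
      have hcont : Tendsto (fun t => F (c t) j) L (𝓝 (F z j)) :=
        ((EuclideanSpace.proj (𝕜 := ℝ) j).continuous.continuousAt.comp hF).tendsto.comp hc
      filter_upwards [hp, hcont.eventually_lt_const hlt] with t ht1 ht2
      rw [if_neg hj, max_eq_right ht2.le]
      positivity
  filter_upwards [hp, eventually_all.2 key] with t ht1 ht2
  refine (Finset.sum_le_sum fun j _ => ht2 j).trans ?_
  rw [← Finset.mul_sum, Finset.sum_add_distrib, Finset.sum_filter]
  gcongr
  simp only [Finset.sum_const, Finset.card_univ, Fintype.card_fin, nsmul_eq_mul]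
  rw [mul_div_assoc', div_le_iff₀ (by positivity)]
  nlinarith

/-- Under an error bound, regular normals to an inequality system have bounded multipliers. -/
theorem exists_multiplier_of_regular_normal {E : Type*} [NormedAddCommGroup E] [NormedSpace ℝ E]
    [FiniteDimensional ℝ E] {r : ℕ} {F : E → Eu r} {zb z : E} {κ δ : ℝ} (hκ : 0 < κ)
    (hnear : ∀ z, ‖z - zb‖ < δ →
      ∃ z', (∀ j, F z' j ≤ 0) ∧ ‖z' - z‖ ≤ κ * ∑ j, max (F z j) 0)
    (hz : ‖z - zb‖ < δ) (hzF : ∀ j, F z j ≤ 0) {F' : E →L[ℝ] Eu r} (hF : HasFDerivAt F F' z)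
    (ℓ : E →L[ℝ] ℝ)
    (hℓ : ∀ ε > (0 : ℝ), ∃ δ' > (0 : ℝ), ∀ z', (∀ j, F z' j ≤ 0) → ‖z' - z‖ < δ' →
      ℓ (z' - z) ≤ ε * ‖z' - z‖) :
    ∃ l : Eu r, (∀ j, 0 ≤ l j ∧ l j ≤ κ * ‖ℓ‖) ∧ (∀ j, F z j ≠ 0 → l j = 0) ∧
      ∀ d, ℓ d = ⟪l, F' d⟫ := by
  classical
  have key : ∀ d, ℓ d ≤ κ * ‖ℓ‖ * ∑ j with F z j = 0, max (F' d j) 0 := by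
    intro d
    set s := ∑ j with F z j = 0, max (F' d j) 0 with hs
    have hline : Tendsto (fun t : ℝ => z + t • d) (𝓝[>] 0) (𝓝 z) := by
      have : Continuous fun t : ℝ => z + t • d := by fun_prop
      simpa using (this.tendsto 0).mono_left nhdsWithin_le_nhds
    have hpos : ∀ᶠ t : ℝ in 𝓝[>] 0, 0 < t := self_mem_nhdsWithin
    have hbound : ∀ ε > (0 : ℝ), ℓ d ≤ ε * (‖d‖ + κ * (s + ε)) + ‖ℓ‖ * (κ * (s + ε)) := by
      intro ε hε
      obtain ⟨δ', hδ', hloc⟩ := hℓ ε hε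
      have h1 := eventually_sum_posPart_le (p := id) (b := fun j => F' d j) hline
        hF.continuousAt hzF hpos (fun j hj η hη => ?_) hε
      · have h2 : ∀ᶠ t : ℝ in 𝓝[>] 0, ‖z + t • d - zb‖ < δ :=
          ((hline.sub_const zb).norm).eventually_lt_const hz
        have h3 : ∀ᶠ t : ℝ in 𝓝[>] 0, t * (‖d‖ + κ * (s + ε)) < δ' := by
          have : Tendsto (fun t : ℝ => t * (‖d‖ + κ * (s + ε))) (𝓝[>] 0) (𝓝 0) := by
            have h : Continuous fun t : ℝ => t * (‖d‖ + κ * (s + ε)) := by fun_prop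
            simpa using (h.tendsto 0).mono_left nhdsWithin_le_nhds
          exact this.eventually_lt_const hδ'
        obtain ⟨t, ht1, ht2, ht3, ht⟩ := (h1.and (h2.and (h3.and hpos))).exists
        obtain ⟨z', hz'F, hz'd⟩ := hnear _ ht2
        have hd1 : ‖z' - (z + t • d)‖ ≤ t * (κ * (s + ε)) := by
          refine hz'd.trans ((mul_le_mul_of_nonneg_left ht1 hκ.le).trans_eq ?_)
          simp only [id]
          ring
        have hd2 : ‖z' - z‖ ≤ t * (‖d‖ + κ * (s + ε)) := by
          have : z' - z = (z' - (z + t • d)) + t • d := by abel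
          rw [this]
          refine (norm_add_le _ _).trans ?_
          rw [norm_smul, Real.norm_of_nonneg ht.le]
          linarith
        have h4 := hloc z' hz'F (hd2.trans_lt ht3)
        have h5 : ℓ (z' - z) = ℓ (z' - (z + t • d)) + t * ℓ d := by
          rw [← smul_eq_mul, ← map_smul, ← map_add]
          congr 1
          abel
        have h6 : -(‖ℓ‖ * (t * (κ * (s + ε)))) ≤ ℓ (z' - (z + t • d)) := by
          refine (abs_le.1 (?_ : |ℓ (z' - (z + t • d))| ≤ _)).1
          exact (ℓ.le_opNorm _).trans (mul_le_mul_of_nonneg_left hd1 (norm_nonneg _))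
        have h7 := mul_le_mul_of_nonneg_left hd2 hε.le
        refine le_of_mul_le_mul_left ?_ ht
        linarith
      · have hd : HasDerivAt (fun t : ℝ => F (z + t • d)) (F' d) 0 := by
          have h1 : HasDerivAt (fun t : ℝ => z + t • d) d 0 := by
            simpa using ((hasDerivAt_id (0 : ℝ)).smul_const d).const_add z
          exact HasFDerivAt.comp_hasDerivAt (x := (0 : ℝ)) (f := fun t : ℝ => z + t • d) (l := F)
            (by simpa using hF) h1
        have hd' : Tendsto (fun t : ℝ => t⁻¹ * F (z + t • d) j) (𝓝[>] 0) (𝓝 (F' d j)) := by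
          have h1 := hd.tendsto_slope_zero_right
          have h2 := ((EuclideanSpace.proj (𝕜 := ℝ) j).continuous.tendsto _).comp h1
          refine h2.congr fun t => ?_
          simp [hj]
        filter_upwards [hd'.eventually_lt_const (lt_add_of_pos_right _ hη), hpos] with t ht1 ht2
        have := mul_lt_mul_of_pos_left ht1 ht2
        rw [mul_inv_cancel_left₀ ht2.ne'] at this
        exact this.le
    have hlim : Tendsto (fun ε : ℝ => ε * (‖d‖ + κ * (s + ε)) + ‖ℓ‖ * (κ * (s + ε))) (𝓝[>] 0)
        (𝓝 (κ * ‖ℓ‖ * s)) := by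
      have h : Continuous fun ε : ℝ => ε * (‖d‖ + κ * (s + ε)) + ‖ℓ‖ * (κ * (s + ε)) := by fun_prop
      have := (h.tendsto 0).mono_left (nhdsWithin_le_nhds (s := Ioi 0))
      convert this using 2
      ring
    exact ge_of_tendsto hlim (eventually_of_mem self_mem_nhdsWithin hbound)
  obtain ⟨l, hl1, hl2, hl3, -⟩ := exists_box_multiplier
    ((WithLp.linearEquiv 2 ℝ (Fin r → ℝ)).toLinearMap ∘ₗ F'.toLinearMap) 0 ℓ.toLinearMap 0
    (κ * ‖ℓ‖) (by positivity) {j | F z j = 0} (by simpa using key) (by simpa using key)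
  refine ⟨WithLp.toLp 2 l, hl1, fun j hj => hl2 j (by simpa using hj), fun d => ?_⟩
  rw [inner_eq_sum]
  exact hl3 d

/-- Second-order Taylor expansion with Peano remainder. -/
theorem exists_taylor_two {E F : Type*} [NormedAddCommGroup E] [NormedSpace ℝ E]
    [NormedAddCommGroup F] [NormedSpace ℝ F] {f : E → F} (hf : ContDiff ℝ 2 f) (y : E)
    {ε : ℝ} (hε : 0 < ε) :
    ∃ δ > (0 : ℝ), ∀ d, ‖d‖ < δ →
      ‖f (y + d) - f y - fderiv ℝ f y d - (1 / 2 : ℝ) • fderiv ℝ (fderiv ℝ f) y d d‖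
        ≤ ε * ‖d‖ ^ 2 := by
  have hf1 : Differentiable ℝ f := hf.differentiable (by norm_num)
  have hf2 : ContDiff ℝ 1 (fderiv ℝ f) := hf.fderiv_right (by norm_num)
  have hf2d : HasFDerivAt (fderiv ℝ f) (fderiv ℝ (fderiv ℝ f) y) y :=
    (hf2.differentiable (by norm_num) y).hasFDerivAt
  have hsymm : ∀ v w, fderiv ℝ (fderiv ℝ f) y v w = fderiv ℝ (fderiv ℝ f) y w v :=
    fun v w => (hf.contDiffAt.isSymmSndFDerivAt (by simp)).eq v w
  have hlo := hf2d.isLittleO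
  obtain ⟨δ, hδ, hball⟩ := Metric.eventually_nhds_iff.1 (hlo.def hε)
  refine ⟨δ, hδ, fun d hd => ?_⟩
  set Q := fderiv ℝ (fderiv ℝ f) y with hQ
  set R : E → F := fun z => f z - fderiv ℝ f y (z - y) - (1 / 2 : ℝ) • Q (z - y) (z - y) with hR
  have hRd : ∀ z, HasFDerivAt R (fderiv ℝ f z - fderiv ℝ f y - Q (z - y)) z := by
    intro z
    have h0 : HasFDerivAt (fun z => z - y) (ContinuousLinearMap.id ℝ E) z :=
      (hasFDerivAt_id z).sub_const y
    have h1 : HasFDerivAt (fun z => fderiv ℝ f y (z - y)) (fderiv ℝ f y) z := by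
      exact (fderiv ℝ f y).hasFDerivAt.comp z h0
    have h2 : HasFDerivAt (fun z => Q (z - y)) Q z := by
      exact Q.hasFDerivAt.comp z h0
    have h3 := (h2.clm_apply h0).const_smul (1 / 2 : ℝ)
    refine (((hf1 z).hasFDerivAt.sub h1).sub h3).congr_fderiv ?_
    ext v
    simp only [sub_apply, smul_apply,
      add_apply, ContinuousLinearMap.comp_apply, ContinuousLinearMap.id_apply,
      ContinuousLinearMap.flip_apply]
    rw [hsymm v (z - y), ← two_smul ℝ, smul_smul]
    norm_num
  have hconv : Convex ℝ (Metric.closedBall y ‖d‖) := convex_closedBall _ _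
  have hmv := hconv.norm_image_sub_le_of_norm_hasFDerivWithin_le (f := R) (C := ε * ‖d‖)
    (f' := fun z => fderiv ℝ f z - fderiv ℝ f y - Q (z - y)) (x := y) (y := y + d)
    (fun z _ => (hRd z).hasFDerivWithinAt) (fun z hz => ?_) (by simp) (by simp)
  · have : R (y + d) - R y = f (y + d) - f y - fderiv ℝ f y d - (1 / 2 : ℝ) • Q d d := by
      simp only [hR, add_sub_cancel_left, sub_self, map_zero, smul_zero, sub_zero]
      abel
    rw [← this]
    refine hmv.trans_eq ?_
    simp
    ring
  · rw [Metric.mem_closedBall, dist_eq_norm] at hz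
    have := hball (y := z) (by rw [dist_eq_norm]; exact hz.trans_lt hd)
    exact this.trans (mul_le_mul_of_nonneg_left hz hε.le)

theorem inner_adjoint_apply {m q : ℕ} (A : Eu m →L[ℝ] Eu q) (l : Eu q) (d : Eu m) :
    ⟪ContinuousLinearMap.adjoint A l, d⟫ = ⟪l, A d⟫ :=
  ContinuousLinearMap.adjoint_inner_left A d l

theorem adjoint_eq_of_forall {m q : ℕ} {A : Eu m →L[ℝ] Eu q} {l : Eu q} {ys : Eu m}
    (h : ∀ d, ⟪ys, d⟫ = ⟪l, A d⟫) : ContinuousLinearMap.adjoint A l = ys :=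
  ext_inner_right ℝ fun d => by rw [inner_adjoint_apply, h]

theorem inner_eq_of_mem_Lam {m q : ℕ} {g : Eu m → Eu q} {y ys : Eu m} {l : Eu q}
    (hl : l ∈ Lam g y ys) (d : Eu m) : ⟪ys, d⟫ = ⟪l, fderiv ℝ g y d⟫ := by
  rw [← hl.2.1, inner_adjoint_apply]

theorem mem_rnc_of_mem_Lam {m q : ℕ} {g : Eu m → Eu q} {y ys : Eu m} {l : Eu q}
    (hg : DifferentiableAt ℝ g y) (hl : l ∈ Lam g y ys) : ys ∈ rnc (Gam g) y := by
  intro ε hε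
  obtain ⟨δ, hδ, hball⟩ := Metric.eventually_nhds_iff.1
    (hg.hasFDerivAt.isLittleO.def (c := ε / (‖l‖ + 1)) (by positivity))
  refine ⟨δ, hδ, fun z hz hzd => ?_⟩
  have h1 := hball (y := z) (by rwa [dist_eq_norm])
  have h2 : ⟪l, g z - g y⟫ ≤ 0 := by
    rw [inner_eq_sum]
    refine Finset.sum_nonpos fun i _ => ?_
    by_cases hi : g y i = 0
    · simpa [hi] using mul_nonpos_of_nonneg_of_nonpos (hl.1 i) (hz i)
    · simp [hl.2.2 i hi]
  have h3 : ⟪ys, z - y⟫ = ⟪l, g z - g y⟫ - ⟪l, g z - g y - fderiv ℝ g y (z - y)⟫ := by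
    rw [inner_eq_of_mem_Lam hl, ← inner_sub_right]
    congr 1
    abel
  have h4 : -⟪l, g z - g y - fderiv ℝ g y (z - y)⟫ ≤ ‖l‖ * (ε / (‖l‖ + 1) * ‖z - y‖) :=
    (neg_le_abs _).trans ((abs_real_inner_le_norm _ _).trans
      (mul_le_mul_of_nonneg_left h1 (norm_nonneg _)))
  have h5 : ‖l‖ * (ε / (‖l‖ + 1) * ‖z - y‖) ≤ ε * ‖z - y‖ := by
    rw [← mul_assoc]
    gcongr
    rw [mul_div_assoc', div_le_iff₀ (by positivity)]
    nlinarith [norm_nonneg l]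
  linarith

theorem exists_mem_Lam_of_mem_rnc {m q : ℕ} {g : Eu m → Eu q} {yb y ys : Eu m} {κ δ : ℝ}
    (hκ : 0 < κ) (hnear : ∀ z, ‖z - yb‖ < δ →
      ∃ z', (∀ j, g z' j ≤ 0) ∧ ‖z' - z‖ ≤ κ * ∑ j, max (g z j) 0)
    (hg : DifferentiableAt ℝ g y) (hyd : ‖y - yb‖ < δ) (hy : y ∈ Gam g)
    (hys : ys ∈ rnc (Gam g) y) :
    ∃ l ∈ Lam g y ys, ∀ i, l i ≤ κ * ‖ys‖ := by
  obtain ⟨l, h1, h2, h3⟩ := exists_multiplier_of_regular_normal hκ hnear hyd hy hg.hasFDerivAt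
    (innerSL ℝ ys) (fun ε hε => hys ε hε)
  rw [innerSL_apply_norm] at h1
  exact ⟨l, ⟨fun i => (h1 i).1, adjoint_eq_of_forall (by simpa using h3), h2⟩, fun i => (h1 i).2⟩

theorem inner_hessA {m q : ℕ} {g : Eu m → Eu q} (hg : ContDiff ℝ 2 g) (l : Eu q) (y v d : Eu m) :
    ⟪d, hessA g l y v⟫ = ⟪l, fderiv ℝ (fderiv ℝ g) y v d⟫ := by
  have hg2 : DifferentiableAt ℝ (fderiv ℝ g) y :=
    (hg.fderiv_right (m := 1) (by norm_num)).differentiable (by norm_num) y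
  have h1 : HasFDerivAt (fun y' => ⟪ContinuousLinearMap.adjoint (fderiv ℝ g y') l, d⟫)
      (innerSL ℝ l ∘L (ContinuousLinearMap.apply ℝ (Eu q) d) ∘L fderiv ℝ (fderiv ℝ g) y) y := by
    simp_rw [inner_adjoint_apply]
    exact (innerSL ℝ l ∘L (ContinuousLinearMap.apply ℝ (Eu q) d)).hasFDerivAt.comp y
      hg2.hasFDerivAt
  have h2 : DifferentiableAt ℝ (fun y' => ContinuousLinearMap.adjoint (fderiv ℝ g y') l) y := by
    have hadj : Differentiable ℝ
        (fun A : Eu m →L[ℝ] Eu q => ContinuousLinearMap.adjoint A l) := by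
      have : Differentiable ℝ (fun A : Eu m →L[ℝ] Eu q => ContinuousLinearMap.adjoint A) :=
        (ContinuousLinearMap.adjoint (𝕜 := ℝ) (E := Eu m)
          (F := Eu q)).toContinuousLinearEquiv.differentiable
      exact this.clm_apply (differentiable_const l)
    exact hadj.differentiableAt.comp y hg2
  have h3 := (h2.hasFDerivAt.inner ℝ (hasFDerivAt_const d y)).unique h1
  have h4 := congrArg (fun f => f v) h3
  simp only [ContinuousLinearMap.comp_apply, ContinuousLinearMap.apply_apply] at h4
  rw [hessA, real_inner_comm]
  simpa using h4

theorem mem_tcone_of_forall_exists {E : Type*} [NormedAddCommGroup E] [NormedSpace ℝ E]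
    {Ω : Set E} {z u : E}
    (h : ∀ ε > (0 : ℝ), ∃ t, 0 < t ∧ t < ε ∧ ∃ x, ‖x - u‖ < ε ∧ z + t • x ∈ Ω) :
    u ∈ tcone Ω z := by
  have hpos : ∀ k : ℕ, (0 : ℝ) < 1 / ((k : ℝ) + 1) := fun k => Nat.one_div_pos_of_nat
  choose t ht htlt x hx hmem using fun k : ℕ => h _ (hpos k)
  refine ⟨t, x, ht, ?_, ?_, hmem⟩
  · exact squeeze_zero (fun k => (ht k).le) (fun k => (htlt k).le)
      tendsto_one_div_add_atTop_nhds_zero_nat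
  · rw [tendsto_iff_norm_sub_tendsto_zero]
    exact squeeze_zero (fun k => norm_nonneg _) (fun k => (hx k).le)
      tendsto_one_div_add_atTop_nhds_zero_nat

/-- A regular normal is polar to the tangent cone. -/
theorem apply_nonpos_of_mem_tcone {E : Type*} [NormedAddCommGroup E] [NormedSpace ℝ E]
    {Ω : Set E} {z u : E} {f : E →L[ℝ] ℝ}
    (hf : ∀ ε > (0 : ℝ), ∃ δ > (0 : ℝ), ∀ p ∈ Ω, ‖p - z‖ < δ → f (p - z) ≤ ε * ‖p - z‖)
    (hu : u ∈ tcone Ω z) : f u ≤ 0 := by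
  obtain ⟨t, x, ht, ht0, hx, hmem⟩ := hu
  have hbound : ∀ ε > (0 : ℝ), f u ≤ ε * ‖u‖ := by
    intro ε hε
    obtain ⟨δ, hδ, h⟩ := hf ε hε
    have h1 : Tendsto (fun k => ‖t k • x k‖) atTop (𝓝 0) := by
      simpa using (ht0.smul hx).norm
    refine le_of_tendsto_of_tendsto ((f.continuous.tendsto u).comp hx) (hx.norm.const_mul ε) ?_
    filter_upwards [h1.eventually_lt_const hδ] with k hk
    have h2 := h _ (hmem k) (by simpa using hk)
    rw [add_sub_cancel_left, map_smul, norm_smul, Real.norm_of_nonneg (ht k).le, smul_eq_mul] at h2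
    refine le_of_mul_le_mul_left ?_ (ht k)
    simp only [Function.comp_apply]
    linarith
  have hlim : Tendsto (fun ε : ℝ => ε * ‖u‖) (𝓝[>] 0) (𝓝 0) := by
    have h : Continuous fun ε : ℝ => ε * ‖u‖ := by fun_prop
    simpa using (h.tendsto 0).mono_left (nhdsWithin_le_nhds (s := Ioi 0))
  exact ge_of_tendsto hlim (eventually_of_mem self_mem_nhdsWithin hbound)

theorem vertical_mem_tcone {m q : ℕ} {g : Eu m → Eu q} {y ys : Eu m} {l n : Eu q}
    (hg : DifferentiableAt ℝ g y) (hy : y ∈ Gam g) (hl : l ∈ Lam g y ys)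
    (hn : ∀ i, 0 ≤ n i ∨ 0 < l i) (hn0 : ∀ i, g y i ≠ 0 → n i = 0) :
    (0, ContinuousLinearMap.adjoint (fderiv ℝ g y) n) ∈ tcone (gphN g) (y, ys) := by
  have hev : ∀ i, ∀ᶠ t : ℝ in 𝓝[>] 0, 0 ≤ l i + t * n i := by
    intro i
    rcases hn i with h | h
    · filter_upwards [self_mem_nhdsWithin] with t (ht : 0 < t)
      have := hl.1 i
      positivity
    · have hc : Continuous fun t : ℝ => l i + t * n i := by fun_prop
      have := (hc.tendsto 0).mono_left (nhdsWithin_le_nhds (s := Ioi 0))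
      rw [zero_mul, add_zero] at this
      exact (this.eventually_const_lt h).mono fun _ => le_of_lt
  refine mem_tcone_of_forall_exists fun ε hε => ?_
  obtain ⟨t, ht, htε, ht0⟩ := ((eventually_all.2 hev).and
    ((eventually_of_mem (Ioo_mem_nhdsGT hε) fun t ht => ht.2).and self_mem_nhdsWithin)).exists
  refine ⟨t, ht0, htε, (0, ContinuousLinearMap.adjoint (fderiv ℝ g y) n), by simpa using hε, ?_⟩
  refine ⟨by simpa using hy, ?_⟩
  simp only [Prod.smul_mk, smul_zero, Prod.mk_add_mk, add_zero]
  refine mem_rnc_of_mem_Lam (l := l + t • n) hg ⟨fun i => by simpa using ht i, ?_, fun i hi => ?_⟩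
  · rw [map_add, map_smul, hl.2.1]
  · simp [hl.2.2 i hi, hn0 i hi]

/-- Near a point with multiplier `l`, the linear form `ys` is bounded on the feasible set by the
Hessian of the Lagrangian. -/
theorem inner_le_neg_hess {m q : ℕ} {g : Eu m → Eu q} {y ys : Eu m} {l : Eu q}
    (hg : ContDiff ℝ 2 g) (hl : l ∈ Lam g y ys) {ε : ℝ} (hε : 0 < ε) :
    ∃ r > (0 : ℝ), ∀ d, ‖d‖ < r → y + d ∈ Gam g →
      ⟪ys, d⟫ ≤ -(1 / 2) * ⟪l, fderiv ℝ (fderiv ℝ g) y d d⟫ + ε * ‖d‖ ^ 2 := by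
  obtain ⟨r, hr, h⟩ := exists_taylor_two hg y (ε := ε / (‖l‖ + 1)) (by positivity)
  refine ⟨r, hr, fun d hd hmem => ?_⟩
  have h1 := h d hd
  have h2 : ⟪l, g (y + d) - g y⟫ ≤ 0 := by
    rw [inner_eq_sum]
    refine Finset.sum_nonpos fun i _ => ?_
    by_cases hi : g y i = 0
    · simpa [hi] using mul_nonpos_of_nonneg_of_nonpos (hl.1 i) (hmem i)
    · simp [hl.2.2 i hi]
  have h3 := (neg_le_abs _).trans ((abs_real_inner_le_norm l _).trans
    (mul_le_mul_of_nonneg_left h1 (norm_nonneg l)))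
  have h4 : ‖l‖ * (ε / (‖l‖ + 1) * ‖d‖ ^ 2) ≤ ε * ‖d‖ ^ 2 := by
    rw [← mul_assoc]
    gcongr
    rw [mul_div_assoc', div_le_iff₀ (by positivity)]
    nlinarith [norm_nonneg l]
  rw [inner_sub_right, inner_sub_right, ← inner_eq_of_mem_Lam hl, real_inner_smul_right] at h3
  linarith

theorem exists_feasible_arc {m q : ℕ} {g : Eu m → Eu q} {yb y ys w : Eu m} {l : Eu q} {κ δ M : ℝ}
    (hg : ContDiff ℝ 2 g) (hκ : 0 < κ)
    (hnear : ∀ z, ‖z - yb‖ < δ →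
      ∃ z', (∀ j, g z' j ≤ 0) ∧ ‖z' - z‖ ≤ κ * ∑ j, max (g z j) 0)
    (hyd : ‖y - yb‖ < δ) (hy : y ∈ Gam g) (hl : l ∈ Lam g y ys) (hlM : ∀ i, l i ≤ M)
    (hM : κ * ‖ys‖ ≤ M)
    (hmax : ∀ l' ∈ Lam g y ys, (∀ i, l' i ≤ M) →
      ⟪l', fderiv ℝ (fderiv ℝ g) y w w⟫ ≤ ⟪l, fderiv ℝ (fderiv ℝ g) y w w⟫)
    (hw : ∀ i, g y i = 0 → fderiv ℝ g y w i ≤ 0) (hw0 : ⟪ys, w⟫ = 0) {ε : ℝ} (hε : 0 < ε) :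
    ∀ᶠ t : ℝ in 𝓝[>] 0, ∃ ξ, y + t • ξ ∈ Gam g ∧ ‖ξ - w‖ < ε ∧
      -(t / 2) * (⟪l, fderiv ℝ (fderiv ℝ g) y w w⟫ + ε) ≤ ⟪ys, ξ⟫ := by
  classical
  set Q := fderiv ℝ (fderiv ℝ g) y with hQ
  set a := Q w w with ha
  have hM0 : 0 ≤ M := le_trans (by positivity) hM
  obtain ⟨z, hz⟩ : ∃ z, M * ∑ i with g y i = 0, max (fderiv ℝ g y z i + a i) 0 <
      ⟪ys, z⟫ + (⟪l, a⟫ + ε / 2) := by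
    by_contra hcon
    push Not at hcon
    obtain ⟨l', h1, h2, h3, h4⟩ := exists_box_multiplier
      ((WithLp.linearEquiv 2 ℝ (Fin q → ℝ)).toLinearMap ∘ₗ (fderiv ℝ g y).toLinearMap) a
      (innerSL ℝ ys).toLinearMap (⟪l, a⟫ + ε / 2) M hM0 {j | g y j = 0} (by simpa using hcon)
      (fun d => by
        change ⟪ys, d⟫ ≤ M * ∑ i with g y i = 0, max (fderiv ℝ g y d i) 0
        rw [inner_eq_of_mem_Lam hl, inner_eq_sum, Finset.mul_sum, Finset.sum_filter]
        refine Finset.sum_le_sum fun i _ => ?_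
        split_ifs with hi
        · refine (mul_le_mul_of_nonneg_left (le_max_left _ 0) (hl.1 i)).trans ?_
          exact mul_le_mul_of_nonneg_right (hlM i) (le_max_right _ _)
        · simp [hl.2.2 i hi])
    have h5 := hmax (WithLp.toLp 2 l') ⟨fun i => (h1 i).1, adjoint_eq_of_forall fun d => by
      rw [inner_eq_sum (WithLp.toLp 2 l')]
      exact h3 d, fun i hi => h2 i (by simpa using hi)⟩ fun i => (h1 i).2
    rw [inner_eq_sum] at h5
    simp only at h5
    linarith
  set σ := ∑ i with g y i = 0, max (fderiv ℝ g y z i + a i) 0 with hσ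
  have hσ0 : 0 ≤ σ := Finset.sum_nonneg fun i _ => le_max_right _ _
  set η := ε / (2 * (M + 1)) with hη
  have hη0 : 0 < η := by positivity
  have hMη : M * η ≤ ε / 2 := by
    rw [hη, mul_div_assoc', div_le_div_iff₀ (by positivity) (by norm_num)]
    nlinarith
  have hpos : ∀ᶠ t : ℝ in 𝓝[>] 0, 0 < t := self_mem_nhdsWithin
  have hc : Tendsto (fun t : ℝ => w + (t / 2) • z) (𝓝[>] 0) (𝓝 w) := by
    have h : Continuous fun t : ℝ => w + (t / 2) • z := by fun_prop
    simpa using (h.tendsto 0).mono_left (nhdsWithin_le_nhds (s := Ioi 0))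
  have hid : Tendsto (fun t : ℝ => t) (𝓝[>] 0) (𝓝 0) := nhdsWithin_le_nhds
  have hΔ : Tendsto (fun t : ℝ => t • (w + (t / 2) • z)) (𝓝[>] 0) (𝓝 0) := by
    simpa using hid.smul hc
  have hcurve : Tendsto (fun t : ℝ => y + t • (w + (t / 2) • z)) (𝓝[>] 0) (𝓝 y) := by
    simpa using hΔ.const_add y
  have hsum := eventually_sum_posPart_le (p := fun t : ℝ => t ^ 2 / 2)
    (b := fun i => fderiv ℝ g y z i + a i) hcurve hg.continuous.continuousAt hy
    (hpos.mono fun t ht => by positivity) (fun i hi θ hθ => ?_) hη0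
  · have h2 : ∀ᶠ t : ℝ in 𝓝[>] 0, ‖y + t • (w + (t / 2) • z) - yb‖ < δ :=
      ((hcurve.sub_const yb).norm).eventually_lt_const hyd
    have h3 : ∀ᶠ t : ℝ in 𝓝[>] 0, t * (‖z‖ / 2 + κ * (σ + η) / 2) < ε := by
      have := hid.mul_const (‖z‖ / 2 + κ * (σ + η) / 2)
      rw [zero_mul] at this
      exact this.eventually_lt_const hε
    filter_upwards [hsum, h2, h3, hpos] with t ht1 ht2 ht3 ht
    obtain ⟨y', hy', hyn⟩ := hnear _ ht2
    set e := y' - (y + t • (w + (t / 2) • z)) with he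
    have hen : ‖e‖ ≤ κ * (t ^ 2 / 2 * (σ + η)) := hyn.trans (mul_le_mul_of_nonneg_left ht1 hκ.le)
    refine ⟨w + (t / 2) • z + t⁻¹ • e, ?_, ?_, ?_⟩
    · have : y + t • (w + (t / 2) • z + t⁻¹ • e) = y' := by
        rw [smul_add t (w + _), smul_inv_smul₀ ht.ne', he]
        abel
      rw [this]
      exact hy'
    · have : w + (t / 2) • z + t⁻¹ • e - w = (t / 2) • z + t⁻¹ • e := by abel
      rw [this]
      refine (norm_add_le _ _).trans_lt (lt_of_le_of_lt ?_ ht3)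
      rw [norm_smul, norm_smul, Real.norm_of_nonneg (by positivity : (0 : ℝ) ≤ t / 2),
        Real.norm_of_nonneg (by positivity : (0 : ℝ) ≤ t⁻¹)]
      have := mul_le_mul_of_nonneg_left hen (by positivity : (0 : ℝ) ≤ t⁻¹)
      have h4 : t⁻¹ * (κ * (t ^ 2 / 2 * (σ + η))) = t * (κ * (σ + η) / 2) := by
        field_simp
      linarith
    · have h4 : -(‖ys‖ * (κ * (t ^ 2 / 2 * (σ + η)))) ≤ ⟪ys, e⟫ :=
        (abs_le.1 ((abs_real_inner_le_norm _ _).trans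
          (mul_le_mul_of_nonneg_left hen (norm_nonneg _)))).1
      have h5 : κ * ‖ys‖ * (σ + η) ≤ M * (σ + η) := by gcongr
      have h6 : κ * ‖ys‖ * (σ + η) ≤ ⟪ys, z⟫ + ⟪l, a⟫ + ε := by linarith
      rw [inner_add_right, inner_add_right, hw0, real_inner_smul_right, real_inner_smul_right]
      have h7 := mul_le_mul_of_nonneg_left h4 (by positivity : (0 : ℝ) ≤ t⁻¹)
      have h8 : t⁻¹ * -(‖ys‖ * (κ * (t ^ 2 / 2 * (σ + η)))) =
          -(t / 2 * (κ * ‖ys‖ * (σ + η))) := by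
        field_simp
      have h9 := mul_le_mul_of_nonneg_left h6 (by positivity : (0 : ℝ) ≤ t / 2)
      linarith
  · set W := ‖w‖ ^ 2 + 1 with hW
    obtain ⟨r, hr, htay⟩ := exists_taylor_two hg y (ε := θ / (4 * W)) (by positivity)
    have hQc : Tendsto (fun t : ℝ => Q (w + (t / 2) • z) (w + (t / 2) • z) i) (𝓝[>] 0)
        (𝓝 (a i)) := by
      have h : Continuous fun t : ℝ => Q (w + (t / 2) • z) (w + (t / 2) • z) i := by fun_prop
      simpa [ha] using (h.tendsto 0).mono_left (nhdsWithin_le_nhds (s := Ioi 0))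
    have hn : Tendsto (fun t : ℝ => ‖t • (w + (t / 2) • z)‖) (𝓝[>] 0) (𝓝 0) := by
      simpa using hΔ.norm
    filter_upwards [hpos, hn.eventually_lt_const hr,
      hQc.eventually_lt_const (by linarith : a i < a i + θ / 2),
      (hc.norm.pow 2).eventually_lt_const (by linarith : ‖w‖ ^ 2 < W)] with t ht h1 h2 h3
    have h4 := (PiLp.norm_apply_le _ i).trans (htay _ h1)
    have h5 := le_of_abs_le h4
    rw [norm_smul, Real.norm_of_nonneg ht.le] at h5
    simp only [map_smul, map_add, PiLp.sub_apply, PiLp.smul_apply, PiLp.add_apply, smul_eq_mul,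
      smul_apply, hi, add_apply] at h5 h2 ⊢
    have h6 : θ / (4 * W) * (t * ‖w + (t / 2) • z‖) ^ 2 ≤ t ^ 2 / 2 * (θ / 2) := by
      rw [mul_pow]
      have : θ / (4 * W) * (t ^ 2 * ‖w + (t / 2) • z‖ ^ 2) ≤ θ / (4 * W) * (t ^ 2 * W) := by
        gcongr
      have hW0 : W ≠ 0 := by positivity
      clear_value W
      refine this.trans_eq ?_
      field_simp
      ring
    have h7 := mul_le_mul_of_nonneg_left h2.le (by positivity : (0 : ℝ) ≤ t ^ 2 / 2)
    have h8 := mul_nonpos_of_nonneg_of_nonpos ht.le (hw i hi)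
    linarith

theorem real_inner_le_mul_sq {m q : ℕ} (l : Eu q) (Q : Eu m →L[ℝ] Eu m →L[ℝ] Eu q) (d : Eu m) :
    |⟪l, Q d d⟫| ≤ ‖l‖ * ‖Q‖ * ‖d‖ ^ 2 := by
  refine (abs_real_inner_le_norm _ _).trans ?_
  rw [mul_assoc, pow_two, ← mul_assoc ‖Q‖]
  exact mul_le_mul_of_nonneg_left (Q.le_opNorm₂ d d) (norm_nonneg l)

/-- A maximizer of a concave quadratic perturbation over the feasible set yields a regular
normal. -/
theorem mem_rnc_of_isMaxOn {E : Type*} [NormedAddCommGroup E] [InnerProductSpace ℝ E] {Ω : Set E}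
    {y d a : E} {R ρ : ℝ} (hR : 0 < R) (hd : ‖d‖ < ρ)
    (h : ∀ d', y + d' ∈ Ω → ‖d'‖ ≤ ρ →
      ⟪a, d'⟫ - R / 2 * ‖d'‖ ^ 2 ≤ ⟪a, d⟫ - R / 2 * ‖d‖ ^ 2) :
    a - R • d ∈ rnc Ω (y + d) := by
  intro ε hε
  refine ⟨min (ρ - ‖d‖) (2 * ε / R), lt_min (by linarith) (by positivity), fun z hz hzd => ?_⟩
  set e := z - (y + d) with he
  have hz' : y + (d + e) = z := by rw [he]; abel
  have h1 := h (d + e) (by rwa [hz'])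
    ((norm_add_le _ _).trans (by linarith [hzd.trans_le (min_le_left _ _)]))
  have h2 : ‖e‖ * R ≤ 2 * ε := ((lt_div_iff₀ hR).1 (hzd.trans_le (min_le_right _ _))).le
  rw [inner_add_right, norm_add_sq_real] at h1
  rw [inner_sub_left, real_inner_smul_left]
  nlinarith [norm_nonneg e]

set_option maxHeartbeats 800000 in
theorem hess_mem_tcone {m q : ℕ} {g : Eu m → Eu q} {yb y ys w : Eu m} {l : Eu q} {κ δ M : ℝ}
    (hg : ContDiff ℝ 2 g) (hκ : 0 < κ)
    (hnear : ∀ z, ‖z - yb‖ < δ →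
      ∃ z', (∀ j, g z' j ≤ 0) ∧ ‖z' - z‖ ≤ κ * ∑ j, max (g z j) 0)
    (hyd : ‖y - yb‖ < δ) (hy : y ∈ Gam g) (hl : l ∈ Lam g y ys) (hlM : ∀ i, l i ≤ M)
    (hM : κ * ‖ys‖ ≤ M)
    (hmax : ∀ l' ∈ Lam g y ys, (∀ i, l' i ≤ M) →
      ⟪l', fderiv ℝ (fderiv ℝ g) y w w⟫ ≤ ⟪l, fderiv ℝ (fderiv ℝ g) y w w⟫)
    (hw : ∀ i, g y i = 0 → fderiv ℝ g y w i ≤ 0) (hw0 : ⟪ys, w⟫ = 0) :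
    (w, hessA g l y w) ∈ tcone (gphN g) (y, ys) := by
  have hHess := fun d => inner_hessA hg l y w d
  set Q := fderiv ℝ (fderiv ℝ g) y with hQ
  have hsymm : ∀ v w, Q v w = Q w v :=
    fun v w => (hg.contDiffAt.isSymmSndFDerivAt (by simp)).eq v w
  set C0 := ‖l‖ * ‖Q‖ with hC0
  have hC00 : 0 ≤ C0 := by positivity
  have hB : ∀ d, |⟪l, Q d d⟫| ≤ C0 * ‖d‖ ^ 2 := real_inner_le_mul_sq l Q
  set H := hessA g l y w with hH
  set R := C0 + 4 with hR
  have hR0 : 0 < R := by positivity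
  set b := R • w + H with hb
  set C := ‖b‖ with hC
  refine mem_tcone_of_forall_exists fun ε hε => ?_
  set ε' := ε / (R + 1) with hε'
  have hε'0 : 0 < ε' := by positivity
  set ε₁ := min 1 (ε' ^ 2 / (2 * (C ^ 2 + 1))) with hε₁
  have hε₁0 : 0 < ε₁ := by positivity
  have hε₁1 : ε₁ ≤ 1 := min_le_left _ _
  have hε₁2 : ε₁ * C ^ 2 ≤ ε' ^ 2 / 2 := by
    have h1 : ε₁ * (2 * (C ^ 2 + 1)) ≤ ε' ^ 2 :=
      (le_div_iff₀ (by positivity)).1 (min_le_right _ _)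
    linarith
  obtain ⟨r, hr, hup⟩ := inner_le_neg_hess hg hl hε₁0
  have hψ : ∃ θ > (0 : ℝ), ∀ ξ, ‖ξ - w‖ < θ →
      ⟪b, w⟫ - R / 2 * ‖w‖ ^ 2 - ε' ^ 2 / 4 < ⟪b, ξ⟫ - R / 2 * ‖ξ‖ ^ 2 := by
    have hc : Continuous fun ξ : Eu m => ⟪b, ξ⟫ - R / 2 * ‖ξ‖ ^ 2 := by fun_prop
    obtain ⟨θ, hθ, h⟩ := Metric.eventually_nhds_iff.1 ((hc.tendsto w).eventually_const_lt
      (by linarith [pow_pos hε'0 2] :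
        ⟪b, w⟫ - R / 2 * ‖w‖ ^ 2 - ε' ^ 2 / 4 < ⟪b, w⟫ - R / 2 * ‖w‖ ^ 2))
    exact ⟨θ, hθ, fun ξ hξ => h (by rwa [dist_eq_norm])⟩
  obtain ⟨θ, hθ, hψ⟩ := hψ
  have harc := exists_feasible_arc (ε := min (min θ (r / 2)) (ε' ^ 2 / 2))
    hg hκ hnear hyd hy hl hlM hM hmax hw hw0 (by positivity)
  have hid : Tendsto (fun t : ℝ => t) (𝓝[>] 0) (𝓝 0) := nhdsWithin_le_nhds
  have hsmall : ∀ᶠ t : ℝ in 𝓝[>] 0, t * C < r / 2 :=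
    (by simpa using hid.mul_const C : Tendsto (fun t : ℝ => t * C) (𝓝[>] 0)
      (𝓝 0)).eventually_lt_const (by positivity)
  have hsmall' : ∀ᶠ t : ℝ in 𝓝[>] 0, t * (‖w‖ + r / 2) < r / 2 :=
    (by simpa using hid.mul_const (‖w‖ + r / 2) : Tendsto (fun t : ℝ => t * (‖w‖ + r / 2)) (𝓝[>] 0)
      (𝓝 0)).eventually_lt_const (by positivity)
  obtain ⟨t, ⟨⟨⟨ξ', hξ'm, hξ'w, hξ'y⟩, htC⟩, htw⟩, htε, ht⟩ := (((harc.and hsmall).and hsmall').and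
    ((hid.eventually_lt_const hε).and self_mem_nhdsWithin)).exists
  have ht : 0 < t := ht
  obtain ⟨d, ⟨hdm, hdr⟩, hdmax⟩ : ∃ d, (y + d ∈ Gam g ∧ ‖d‖ ≤ r / 2) ∧
      ∀ d', y + d' ∈ Gam g → ‖d'‖ ≤ r / 2 →
        ⟪ys + t • b, d'⟫ - R / 2 * ‖d'‖ ^ 2 ≤ ⟪ys + t • b, d⟫ - R / 2 * ‖d‖ ^ 2 := by
    have hcl : IsClosed {d : Eu m | y + d ∈ Gam g} := by
      have : {d : Eu m | y + d ∈ Gam g} = ⋂ i, {d | g (y + d) i ≤ 0} := by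
        ext d; simp [Gam]
      rw [this]
      have := hg.continuous
      exact isClosed_iInter fun i => isClosed_le (by fun_prop) continuous_const
    have hK : IsCompact ({d : Eu m | y + d ∈ Gam g} ∩ Metric.closedBall 0 (r / 2)) :=
      (isCompact_closedBall _ _).inter_left hcl
    obtain ⟨d, hd, hmax⟩ := hK.exists_isMaxOn ⟨0, by simpa using hy, by simp; positivity⟩
      (f := fun d => ⟪ys + t • b, d⟫ - R / 2 * ‖d‖ ^ 2) (by fun_prop)
    exact ⟨d, ⟨hd.1, by simpa using hd.2⟩, fun d' h1 h2 => hmax ⟨h1, by simpa using h2⟩⟩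
  have hyd' := hup d (by linarith) hdm
  have hbd := (le_abs_self _).trans (abs_real_inner_le_norm b d)
  have hdC : ‖d‖ ≤ t * C := by
    have h0 := hdmax 0 (by simpa using hy) (by simp; positivity)
    simp only [inner_zero_right, norm_zero, inner_add_left, real_inner_smul_left] at h0
    have h2 := (abs_le.1 (hB d)).1
    have h3 := mul_le_mul_of_nonneg_left hbd ht.le
    have h4 : ε₁ * ‖d‖ ^ 2 ≤ 1 * ‖d‖ ^ 2 := by gcongr
    rcases (norm_nonneg d).eq_or_lt with h5 | h5
    · rw [← h5]; positivity
    · refine le_of_mul_le_mul_right ?_ h5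
      rw [hR] at h0
      linarith
  set ξ := t⁻¹ • d with hξ
  have htξ : t • ξ = d := smul_inv_smul₀ ht.ne' d
  have hξC : ‖ξ‖ ≤ C := by
    rw [← htξ, norm_smul, Real.norm_of_nonneg ht.le] at hdC
    exact le_of_mul_le_mul_left hdC ht
  have hcmp := hdmax (t • ξ') hξ'm (by
    rw [norm_smul, Real.norm_of_nonneg ht.le]
    have : ‖ξ'‖ ≤ ‖w‖ + r / 2 := by
      have := norm_le_norm_add_norm_sub' ξ' w
      have := hξ'w.trans_le ((min_le_left _ _).trans (min_le_right _ _))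
      linarith
    exact (mul_le_mul_of_nonneg_left this ht.le).trans htw.le)
  have hψ' := hψ ξ' (hξ'w.trans_le ((min_le_left _ _).trans (min_le_left _ _)))
  have hmin : min (min θ (r / 2)) (ε' ^ 2 / 2) ≤ ε' ^ 2 / 2 := min_le_right _ _
  have hkey : 2 * ‖ξ - w‖ ^ 2 ≤ ε' ^ 2 := by
    have e1 : ⟪l, Q (ξ - w) (ξ - w)⟫ = ⟪l, Q ξ ξ⟫ - 2 * ⟪ξ, H⟫ + ⟪w, H⟫ := by
      rw [hHess, hHess]
      simp only [map_sub, sub_apply, inner_sub_right, hsymm ξ w]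
      ring
    have e2 := (abs_le.1 (hB (ξ - w))).1
    have e3 : ⟪l, Q w w⟫ = ⟪w, H⟫ := (hHess w).symm
    rw [← htξ] at hcmp hyd'
    simp only [inner_add_left, real_inner_smul_left, real_inner_smul_right, norm_smul, mul_pow,
      Real.norm_of_nonneg ht.le, map_smul, smul_apply] at hcmp hyd'
    have e4 : t ^ 2 * (-(1 / 2) * (⟪l, Q w w⟫ + ε' ^ 2 / 2) + (⟪b, ξ'⟫ - R / 2 * ‖ξ'‖ ^ 2)) ≤
        t ^ 2 * (-(1 / 2) * ⟪l, Q ξ ξ⟫ + ε₁ * ‖ξ‖ ^ 2 + (⟪b, ξ⟫ - R / 2 * ‖ξ‖ ^ 2)) := by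
      have := mul_le_mul_of_nonneg_left hξ'y ht.le
      have := mul_le_mul_of_nonneg_left hmin (sq_nonneg t)
      linarith
    have e5 := le_of_mul_le_mul_left e4 (by positivity)
    have e6 : ε₁ * ‖ξ‖ ^ 2 ≤ ε₁ * C ^ 2 := by gcongr
    have e7 : ∀ x, ⟪b, x⟫ = R * ⟪x, w⟫ + ⟪x, H⟫ := fun x => by
      rw [hb, inner_add_left, real_inner_smul_left, real_inner_comm x w, real_inner_comm x H]
    rw [e7 w, e7 ξ'] at hψ'
    rw [e7 ξ, e7 ξ'] at e5
    rw [real_inner_self_eq_norm_sq] at hψ'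
    have e8 := norm_sub_sq_real ξ w
    have e9 : C0 = R - 4 := by rw [hR]; ring
    rw [e8, e1, e9] at e2
    rw [e8]
    rw [e3] at e5
    linarith
  have hlt : ‖ξ - w‖ < ε' := by
    nlinarith [norm_nonneg (ξ - w)]
  have hRε : (R + 1) * ε' = ε := by rw [hε']; field_simp
  refine ⟨t, ht, htε, (ξ, b - R • ξ), ?_, ?_, ?_⟩
  · have : b - R • ξ - H = -(R • (ξ - w)) := by rw [hb, smul_sub]; abel
    rw [Prod.mk_sub_mk, Prod.norm_mk, this, norm_neg, norm_smul, Real.norm_of_nonneg hR0.le]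
    exact max_lt (by nlinarith) (by nlinarith)
  · simpa [htξ] using hdm
  · have := mem_rnc_of_isMaxOn hR0 (hdC.trans_lt htC) hdmax
    have e : ys + t • (b - R • ξ) = ys + t • b - R • d := by
      rw [smul_sub, smul_comm t R, htξ, add_sub_assoc]
    simpa [htξ, e] using this

theorem norm_le_sum_of_nonneg {q : ℕ} {l : Eu q} (h : ∀ i, 0 ≤ l i) : ‖l‖ ≤ ∑ i, l i := by
  rw [EuclideanSpace.norm_eq, Real.sqrt_le_left (Finset.sum_nonneg fun i _ => h i)]
  refine (Finset.sum_le_sum fun i _ => ?_).trans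
    (Finset.sum_sq_le_sq_sum_of_nonneg fun i _ => h i)
  simp

/-- The multiplier mapping has closed graph along convergent families in the feasible set. -/
theorem mem_Lam_of_tendsto {m q : ℕ} {ι : Type*} {L : Filter ι} [L.NeBot] {g : Eu m → Eu q}
    (hg : ContDiff ℝ 1 g) {y ys : ι → Eu m} {l : ι → Eu q} {y₀ ys₀ : Eu m} {l₀ : Eu q}
    (hmem : ∀ᶠ k in L, l k ∈ Lam g (y k) (ys k)) (hy : Tendsto y L (𝓝 y₀))
    (hys : Tendsto ys L (𝓝 ys₀)) (hl : Tendsto l L (𝓝 l₀)) : l₀ ∈ Lam g y₀ ys₀ := by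
  have hli : ∀ i, Tendsto (fun k => l k i) L (𝓝 (l₀ i)) := fun i =>
    ((by fun_prop : Continuous fun x : Eu q => x i).tendsto l₀).comp hl
  refine ⟨fun i => ge_of_tendsto (hli i) (hmem.mono fun k hk => hk.1 i), ?_, fun i hi => ?_⟩
  · refine adjoint_eq_of_forall fun d => ?_
    have hA : Tendsto (fun k => fderiv ℝ g (y k) d) L (𝓝 (fderiv ℝ g y₀ d)) :=
      ((by have := hg.continuous_fderiv (by norm_num); fun_prop :
        Continuous fun x => fderiv ℝ g x d).tendsto y₀).comp hy
    refine tendsto_nhds_unique (hys.inner tendsto_const_nhds) ((hl.inner hA).congr' ?_)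
    filter_upwards [hmem] with k hk
    rw [inner_eq_of_mem_Lam hk]
  · have h1 : Tendsto (fun k => g (y k) i) L (𝓝 (g y₀ i)) :=
      ((by have := hg.continuous; fun_prop : Continuous fun x => g x i).tendsto y₀).comp hy
    refine tendsto_nhds_unique (hli i) (tendsto_const_nhds.congr' ?_)
    filter_upwards [hmem, h1.eventually_ne hi] with k hk hk'
    rw [hk.2.2 i hk']

theorem isCompact_Lam_inter {m q : ℕ} {g : Eu m → Eu q} (y ys : Eu m) (M : ℝ) :
    IsCompact {l | l ∈ Lam g y ys ∧ ∀ i, l i ≤ M} := by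
  refine Metric.isCompact_of_isClosed_isBounded ?_ ?_
  · have : {l | l ∈ Lam g y ys ∧ ∀ i, l i ≤ M} = (⋂ i, {l | 0 ≤ l i}) ∩
        {l | ContinuousLinearMap.adjoint (fderiv ℝ g y) l = ys} ∩
        (⋂ i, {l : Eu q | g y i ≠ 0 → l i = 0}) ∩ ⋂ i, {l | l i ≤ M} := by
      ext l
      simp only [Lam, mem_ofPred_eq, mem_inter_iff, mem_iInter]
      tauto
    rw [this]
    refine (((isClosed_iInter fun i => isClosed_le continuous_const (by fun_prop)).inter
      (isClosed_eq (by fun_prop) continuous_const)).inter (isClosed_iInter fun i => ?_)).inter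
      (isClosed_iInter fun i => isClosed_le (by fun_prop) continuous_const)
    by_cases hi : g y i = 0
    · simp [hi]
    · simpa [hi] using isClosed_eq (by fun_prop : Continuous fun l : Eu q => l i) continuous_const
  · refine isBounded_iff_forall_norm_le.2 ⟨q * M, fun l hl => ?_⟩
    refine (norm_le_sum_of_nonneg hl.1.1).trans ?_
    simpa using Finset.sum_le_sum fun i (_ : i ∈ Finset.univ) => hl.2 i

/-- Necessary conditions satisfied by regular normals to the graph of the normal cone map. -/
theorem regular_normal_gphN {m q : ℕ} {g : Eu m → Eu q} {yb y ys α w : Eu m} {κ δ : ℝ}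
    (hg : ContDiff ℝ 2 g) (hκ : 0 < κ)
    (hnear : ∀ z, ‖z - yb‖ < δ →
      ∃ z', (∀ j, g z' j ≤ 0) ∧ ‖z' - z‖ ≤ κ * ∑ j, max (g z j) 0)
    (hyd : ‖y - yb‖ < δ) (hp : (y, ys) ∈ gphN g)
    (hn : ∀ ε > (0 : ℝ), ∃ δ' > (0 : ℝ), ∀ p ∈ gphN g, ‖p - (y, ys)‖ < δ' →
      ⟪α, p.1 - y⟫ + ⟪w, p.2 - ys⟫ ≤ ε * ‖p - (y, ys)‖) :
    (∀ l ∈ Lam g y ys, ∀ i, 0 < l i → fderiv ℝ g y w i = 0) ∧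
      ∀ l ∈ Lam g y ys, ⟪α, w⟫ + ⟪l, fderiv ℝ (fderiv ℝ g) y w w⟫ ≤ 0 := by
  have hgd : DifferentiableAt ℝ g y := hg.differentiable (by norm_num) y
  have hpolar : ∀ p ∈ tcone (gphN g) (y, ys), ⟪α, p.1⟫ + ⟪w, p.2⟫ ≤ 0 := fun p hp =>
    apply_nonpos_of_mem_tcone (f := (innerSL ℝ α).coprod (innerSL ℝ w))
      (fun ε hε => by simpa using hn ε hε) hp
  have hvert : ∀ l ∈ Lam g y ys, ∀ n : Eu q, (∀ i, 0 ≤ n i ∨ 0 < l i) →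
      (∀ i, g y i ≠ 0 → n i = 0) → ⟪n, fderiv ℝ g y w⟫ ≤ 0 := fun l hl n h1 h2 => by
    have := hpolar _ (vertical_mem_tcone hgd hp.1 hl h1 h2)
    rwa [inner_zero_right, zero_add, real_inner_comm, inner_adjoint_apply] at this
  obtain ⟨l₀, hl₀, hl₀M⟩ := exists_mem_Lam_of_mem_rnc hκ hnear hgd hyd hp.1 hp.2
  have hact : ∀ i, g y i = 0 → fderiv ℝ g y w i ≤ 0 := fun i hi => by
    have := hvert l₀ hl₀ (EuclideanSpace.single i 1) (fun j => Or.inl (by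
      by_cases h : j = i <;> simp [h])) (fun j hj => by
      have : j ≠ i := by rintro rfl; exact hj hi
      simp [this])
    simpa [inner_eq_sum, Pi.single_apply] using this
  have hpos : ∀ l ∈ Lam g y ys, ∀ i, 0 < l i → fderiv ℝ g y w i = 0 := fun l hl i hi => by
    have hgi : g y i = 0 := by
      by_contra h
      exact hi.ne' (hl.2.2 i h)
    have := hvert l hl (EuclideanSpace.single i (-1)) (fun j => by
      by_cases h : j = i
      · exact Or.inr (h ▸ hi)
      · exact Or.inl (by simp [h])) (fun j hj => by
      have : j ≠ i := by rintro rfl; exact hj hgi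
      simp [this])
    exact le_antisymm (hact i hgi) (by
      simpa [inner_eq_sum, Pi.single_apply] using this)
  refine ⟨hpos, fun l hl => ?_⟩
  have hw0 : ⟪ys, w⟫ = 0 := by
    rw [inner_eq_of_mem_Lam hl, inner_eq_sum]
    refine Finset.sum_eq_zero fun i _ => ?_
    rcases (hl.1 i).eq_or_lt with h | h
    · simp [← h]
    · simp [hpos l hl i h]
  set M := κ * ‖ys‖ + ∑ i, l i with hM
  have hle : ∀ i, l i ≤ M := fun i => by
    have := Finset.single_le_sum (fun j _ => hl.1 j) (Finset.mem_univ i)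
    have : 0 ≤ κ * ‖ys‖ := by positivity
    linarith
  obtain ⟨l', hl', hmax⟩ := (isCompact_Lam_inter y ys M).exists_isMaxOn ⟨l, hl, hle⟩
    (f := fun l => ⟪l, fderiv ℝ (fderiv ℝ g) y w w⟫) (by fun_prop)
  have h1 := hpolar _ (hess_mem_tcone hg hκ hnear hyd hp.1 hl'.1 hl'.2
    (by rw [hM]; linarith [Finset.sum_nonneg fun i (_ : i ∈ Finset.univ) => hl.1 i])
    (fun l'' h h' => hmax ⟨h, h'⟩) hact hw0)
  simp only [inner_hessA hg] at h1
  have h2 : ⟪l, fderiv ℝ (fderiv ℝ g) y w w⟫ ≤ ⟪l', fderiv ℝ (fderiv ℝ g) y w w⟫ :=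
    hmax ⟨hl, hle⟩
  linarith

theorem mem_gphN_of_tendsto {m q : ℕ} {g : Eu m → Eu q} {yb y₀ ys₀ : Eu m} {κ δ : ℝ}
    (hg : ContDiff ℝ 1 g) (hκ : 0 < κ)
    (hnear : ∀ z, ‖z - yb‖ < δ →
      ∃ z', (∀ j, g z' j ≤ 0) ∧ ‖z' - z‖ ≤ κ * ∑ j, max (g z j) 0)
    {p : ℕ → Eu m × Eu m} (hp : ∀ k, p k ∈ gphN g) (hpd : ∀ k, ‖(p k).1 - yb‖ < δ)
    (hlim : Tendsto p atTop (𝓝 (y₀, ys₀))) : (y₀, ys₀) ∈ gphN g := by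
  have hgd := hg.differentiable (by norm_num)
  have hy := (continuous_fst.tendsto _).comp hlim
  have hys := (continuous_snd.tendsto _).comp hlim
  choose l hl hlM using fun k =>
    exists_mem_Lam_of_mem_rnc hκ hnear (hgd _) (hpd k) (hp k).1 (hp k).2
  obtain ⟨B, hB⟩ := hys.norm.bddAbove_range
  have hB : ∀ k, ‖(p k).2‖ ≤ B := fun k => hB ⟨k, rfl⟩
  have hbdd : ∀ k, l k ∈ Metric.closedBall (0 : Eu q) (∑ _i : Fin q, κ * B) := fun k => by
    rw [mem_closedBall_zero_iff]
    refine (norm_le_sum_of_nonneg (hl k).1).trans (Finset.sum_le_sum fun i _ => ?_)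
    exact (hlM k i).trans (mul_le_mul_of_nonneg_left (hB k) hκ.le)
  obtain ⟨l₀, -, s, hs, hl₀⟩ := (isCompact_closedBall _ _).tendsto_subseq hbdd
  refine ⟨fun i => ?_, ?_⟩
  · have : Continuous fun x => g x i := by
      have := hg.continuous
      fun_prop
    exact le_of_tendsto ((this.tendsto _).comp hy) (Eventually.of_forall fun k => (hp k).1 i)
  · exact mem_rnc_of_mem_Lam (hgd _) (mem_Lam_of_tendsto hg (Eventually.of_forall fun k => hl (s k))
      (hy.comp hs.tendsto_atTop) (hys.comp hs.tendsto_atTop) hl₀)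

/-- The solution set of the equilibrium system `0 ∈ φ(x,y) + N̂_Γ(y)`, `G(x,y) ≤ 0`. -/
def mpecSol {n m p q : ℕ} (φ : Eu n × Eu m → Eu m) (G : Eu n × Eu m → Eu p) (g : Eu m → Eu q) :
    Set (Eu n × Eu m) :=
  {z | (z.2, -φ z) ∈ gphN g ∧ ∀ j, G z j ≤ 0}

theorem exists_of_not_msr {E F : Type*} [NormedAddCommGroup E] [NormedAddCommGroup F]
    {M : E → Set F} {zb : E} (h : ¬ msr M zb 0) {κ r : ℝ} (hκ : 0 < κ)
    (hr : 0 < r) : ∃ z, ‖z - zb‖ < r ∧ ∃ w ∈ M z, ∀ s, 0 ∈ M s → κ * ‖w‖ < ‖z - s‖ := by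
  by_contra hcon
  push Not at hcon
  refine h ⟨κ, hκ, Metric.ball zb r, Metric.ball_mem_nhds _ hr, fun z hz => ?_⟩
  rw [mem_ball_iff_norm] at hz
  have hκ' : ENNReal.ofReal κ ≠ 0 := by simpa using hκ
  rw [mul_comm, ← ENNReal.div_le_iff_le_mul (Or.inl hκ') (Or.inl ENNReal.ofReal_ne_top)]
  refine Metric.le_infEDist.2 fun w hw => ?_
  obtain ⟨s, hs, hle⟩ := hcon z hz w hw
  rw [ENNReal.div_le_iff_le_mul (Or.inl hκ') (Or.inl ENNReal.ofReal_ne_top)]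
  refine (Metric.infEDist_le_edist_of_mem (show s ∈ {z' | 0 ∈ M z'} from hs)).trans ?_
  rw [edist_dist, edist_dist, dist_zero_left, dist_eq_norm, mul_comm, ← ENNReal.ofReal_mul hκ.le]
  exact ENNReal.ofReal_le_ofReal (by linarith)

/-- Local bounds for the derivative of a continuously differentiable map. -/
theorem exists_fderiv_bound {E F : Type*} [NormedAddCommGroup E] [NormedSpace ℝ E]
    [NormedAddCommGroup F] [NormedSpace ℝ F] {φ : E → F} (hφ : ContDiff ℝ 1 φ) (zb : E) :
    ∃ R > (0 : ℝ), (∀ z, ‖z - zb‖ < R → ‖fderiv ℝ φ z‖ ≤ ‖fderiv ℝ φ zb‖ + 1) ∧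
      ∀ z z', ‖z - zb‖ < R → ‖z' - zb‖ < R →
        ‖φ z' - φ z‖ ≤ (‖fderiv ℝ φ zb‖ + 1) * ‖z' - z‖ := by
  obtain ⟨R, hR, h⟩ := Metric.eventually_nhds_iff.1
    (((hφ.continuous_fderiv (by norm_num)).norm.tendsto zb).eventually_lt_const
      (lt_add_one ‖fderiv ℝ φ zb‖))
  refine ⟨R, hR, fun z hz => (h (by rwa [dist_eq_norm])).le, fun z z' hz hz' => ?_⟩
  refine (convex_ball zb R).norm_image_sub_le_of_norm_fderiv_le (𝕜 := ℝ)
    (fun x _ => hφ.differentiable (by norm_num) x) (fun x hx => (h (Metric.mem_ball.1 hx)).le)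
    (mem_ball_iff_norm.2 hz) (mem_ball_iff_norm.2 hz')

/-- If metric subregularity fails, there are points with arbitrarily small residual relative to
the distance to the solution set. -/
theorem exists_far_quasi_solution {n m p q : ℕ} {φ : Eu n × Eu m → Eu m}
    {G : Eu n × Eu m → Eu p} {g : Eu m → Eu q} (hφ : ContDiff ℝ 1 φ) {zb : Eu n × Eu m}
    (hzb : zb ∈ mpecSol φ G g) {κ δ : ℝ} (hκ : 0 < κ) (hδ : 0 < δ)
    (hnear : ∀ z, ‖z - zb‖ < δ →
      ∃ z', (∀ j, G z' j ≤ 0) ∧ ‖z' - z‖ ≤ κ * ∑ j, max (G z j) 0)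
    (hnot : ¬ msr (fun z : Eu n × Eu m => {w : Eu m × Eu p |
      (z.2 ∈ Gam g ∧ w.1 - φ z ∈ rnc (Gam g) z.2) ∧ ∀ j, G z j - w.2 j ≤ 0}) zb (0, 0))
    {K r : ℝ} (hK : 0 < K) (hr : 0 < r) :
    ∃ f > (0 : ℝ), ∃ z : Eu n × Eu m, ∃ y' ys : Eu m, ‖z - zb‖ < r ∧ (∀ j, G z j ≤ 0) ∧
      (y', ys) ∈ gphN g ∧ ‖z.2 - y'‖ ^ 2 + ‖φ z + ys‖ ^ 2 ≤ f ^ 2 ∧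
      ∀ s ∈ mpecSol φ G g, K * f ≤ ‖z - s‖ := by
  obtain ⟨R, hR, -, hlip⟩ := exists_fderiv_bound hφ zb
  set Λ := ‖fderiv ℝ φ zb‖ + 1 with hΛ
  have hΛ0 : 0 < Λ := by positivity
  set D := κ * p with hD
  have hD0 : 0 ≤ D := by positivity
  set C := D + Λ * D + 1 with hC
  have hΛD : 0 ≤ Λ * D := by positivity
  have hC0 : 0 < C := by positivity
  obtain ⟨z, hz, w, ⟨⟨hw1, hw2⟩, hw3⟩, hfar⟩ := exists_of_not_msr hnot
    (κ := (K + 1) * C) (r := min δ (min R r / 2)) (by positivity) (by positivity)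
  have hfar' : ∀ s ∈ mpecSol φ G g, (K + 1) * C * ‖w‖ < ‖z - s‖ := fun s hs =>
    hfar s ⟨⟨hs.1.1, by simpa using hs.1.2⟩, by simpa using hs.2⟩
  have hw0 : 0 < ‖w‖ := by
    rw [norm_pos_iff]
    rintro rfl
    have := hfar z ⟨⟨hw1, hw2⟩, hw3⟩
    simp at this
  obtain ⟨z', hz'G, hz'⟩ := hnear z (hz.trans_le (min_le_left _ _))
  have hsum : ∑ j, max (G z j) 0 ≤ p * ‖w‖ := by
    have : ∀ j ∈ Finset.univ, max (G z j) 0 ≤ ‖w‖ := fun j _ => by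
      refine max_le ?_ (norm_nonneg w)
      have := hw3 j
      have h1 := (PiLp.norm_apply_le w.2 j).trans (norm_snd_le w)
      have h2 := le_of_abs_le h1
      linarith
    simpa using Finset.sum_le_sum this
  have hzz' : ‖z' - z‖ ≤ D * ‖w‖ := hz'.trans (by rw [hD, mul_assoc]; gcongr)
  have hzb2 : ‖z - zb‖ < min R r / 2 := hz.trans_le (min_le_right _ _)
  have hz'zb : ‖z' - zb‖ < min R r := by
    have h1 := hfar' zb hzb
    have h2 := norm_sub_le_norm_sub_add_norm_sub z' z zb
    have h3 : D * ‖w‖ ≤ (K + 1) * C * ‖w‖ := by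
      gcongr
      nlinarith
    linarith
  have hφz := hlip z z' (hzb2.trans_le (by linarith [min_le_left R r, lt_min hR hr]))
    (hz'zb.trans_le (min_le_left _ _))
  refine ⟨C * ‖w‖, by positivity, z', z.2, w.1 - φ z, hz'zb.trans_le (min_le_right _ _), hz'G,
    ⟨hw1, hw2⟩, ?_, fun s hs => ?_⟩
  · have h1 : ‖z'.2 - z.2‖ ≤ D * ‖w‖ := (norm_snd_le (z' - z)).trans hzz'
    have h2 : ‖φ z' + (w.1 - φ z)‖ ≤ (Λ * D + 1) * ‖w‖ := by
      have e : φ z' + (w.1 - φ z) = (φ z' - φ z) + w.1 := by abel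
      rw [e]
      have h3 := mul_le_mul_of_nonneg_left hzz' hΛ0.le
      have h4 := norm_fst_le w
      refine (norm_add_le _ _).trans ?_
      linarith
    calc _ ≤ (D * ‖w‖) ^ 2 + ((Λ * D + 1) * ‖w‖) ^ 2 := by gcongr
      _ ≤ (D * ‖w‖ + (Λ * D + 1) * ‖w‖) ^ 2 := by
        have : 0 ≤ (D * ‖w‖) * ((Λ * D + 1) * ‖w‖) := by positivity
        linarith
      _ = _ := by rw [hC]; ring
  · have h1 := hfar' s hs
    have h2 := norm_sub_le_norm_sub_add_norm_sub z z' s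
    rw [norm_sub_rev z z'] at h2
    have h3 : D * ‖w‖ ≤ C * ‖w‖ := by
      gcongr
      linarith
    linarith

theorem isCompact_gphN_inter {m q : ℕ} {g : Eu m → Eu q} {yb : Eu m} {κ δ R : ℝ}
    (hg : ContDiff ℝ 1 g) (hκ : 0 < κ)
    (hnear : ∀ z, ‖z - yb‖ < δ →
      ∃ z', (∀ j, g z' j ≤ 0) ∧ ‖z' - z‖ ≤ κ * ∑ j, max (g z j) 0) (hR : R < δ) (c : Eu m) :
    IsCompact {p | p ∈ gphN g ∧ ‖p.1 - yb‖ ≤ R ∧ ‖p.2 + c‖ ≤ 1} := by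
  refine Metric.isCompact_of_isClosed_isBounded (IsSeqClosed.isClosed fun p p₀ hp hlim => ?_) ?_
  · have h1 := (continuous_fst.tendsto p₀).comp hlim
    have h2 := (continuous_snd.tendsto p₀).comp hlim
    exact ⟨mem_gphN_of_tendsto hg hκ hnear (fun k => (hp k).1) (fun k => (hp k).2.1.trans_lt hR)
        hlim,
      le_of_tendsto (h1.sub_const yb).norm (Eventually.of_forall fun k => (hp k).2.1),
      le_of_tendsto (h2.add_const c).norm (Eventually.of_forall fun k => (hp k).2.2)⟩
  · refine ((Metric.isBounded_closedBall (x := yb) (r := R)).prod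
      (Metric.isBounded_closedBall (x := -c) (r := 1))).subset fun p hp => ⟨?_, ?_⟩
    · simpa [dist_eq_norm] using hp.2.1
    · simpa [dist_eq_norm] using hp.2.2

/-- Approximate stationarity of a feasible point `z` together with a point of the graph of the
normal cone map, at a scale governed by the distance of `z` to `zb`. -/
structure IsApproxStationary {n m p q : ℕ} (φ : Eu n × Eu m → Eu m) (G : Eu n × Eu m → Eu p)
    (g : Eu m → Eu q) (zb : Eu n × Eu m) (C ε : ℝ) (z : Eu n × Eu m) (y' ys α w : Eu m)
    (η : Eu p) : Prop where
  nonpos : ∀ j, G z j ≤ 0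
  mem_gphN : (y', ys) ∈ gphN g
  pos : 0 < ‖z - zb‖
  lt : ‖z - zb‖ < ε
  dist_le : ‖z.2 - y'‖ ≤ ε * ‖z - zb‖
  residual_le : ‖φ z + ys‖ ≤ ε * ‖z - zb‖
  unit : ‖α‖ ^ 2 + ‖w‖ ^ 2 = 1
  normal : ∀ ε' > (0 : ℝ), ∃ δ' > (0 : ℝ), ∀ p ∈ gphN g, ‖p - (y', ys)‖ < δ' →
    ⟪α, p.1 - y'⟫ + ⟪w, p.2 - ys⟫ ≤ ε' * ‖p - (y', ys)‖
  mult_nonneg : ∀ j, 0 ≤ η j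
  mult_le : ∀ j, η j ≤ C
  mult_compl : ∀ j, G z j ≠ 0 → η j = 0
  stationary : ∀ d, |⟪α, d.2⟫ - ⟪w, fderiv ℝ φ z d⟫ + ⟪η, fderiv ℝ G z d⟫| ≤ ε * ‖d‖

theorem regular_normal_of_min {E : Type*} [NormedAddCommGroup E] [InnerProductSpace ℝ E]
    {Ω : Set (E × E)} {p₀ : E × E} {a b : E} {ν r : ℝ} (hν : 0 < ν) (hr : 0 < r)
    (h : ∀ p ∈ Ω, ‖p - p₀‖ < r →
      ‖a‖ ^ 2 + ‖b‖ ^ 2 ≤ ‖a - (p - p₀).1‖ ^ 2 + ‖b + (p - p₀).2‖ ^ 2) :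
    ∀ ε > (0 : ℝ), ∃ δ > (0 : ℝ), ∀ p ∈ Ω, ‖p - p₀‖ < δ →
      ⟪ν⁻¹ • a, p.1 - p₀.1⟫ + ⟪-(ν⁻¹ • b), p.2 - p₀.2⟫ ≤ ε * ‖p - p₀‖ := by
  intro ε hε
  refine ⟨min r (ν * ε), by positivity, fun p hp hpd => ?_⟩
  have h1 := h p hp (hpd.trans_le (min_le_left _ _))
  have h2 : ‖p - p₀‖ * ‖p - p₀‖ ≤ ν * ε * ‖p - p₀‖ := by
    gcongr
    exact (hpd.trans_le (min_le_right _ _)).le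
  have h3 := pow_le_pow_left₀ (norm_nonneg _) (norm_fst_le (p - p₀)) 2
  have h4 := pow_le_pow_left₀ (norm_nonneg _) (norm_snd_le (p - p₀)) 2
  rw [norm_sub_sq_real, norm_add_sq_real] at h1
  rw [inner_neg_left, real_inner_smul_left, real_inner_smul_left, ← Prod.fst_sub, ← Prod.snd_sub]
  refine le_of_mul_le_mul_left ?_ hν
  have e : ν * (ν⁻¹ * ⟪a, (p - p₀).1⟫ + -(ν⁻¹ * ⟪b, (p - p₀).2⟫)) =
      ⟪a, (p - p₀).1⟫ - ⟪b, (p - p₀).2⟫ := by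
    field_simp
    ring
  rw [e]
  linarith

/-- The negative derivative at a local minimizer on a set is a regular normal. -/
theorem neg_apply_le_of_min {E : Type*} [NormedAddCommGroup E] [NormedSpace ℝ E] {P : E → Prop}
    {F : E → ℝ} {D : E →L[ℝ] ℝ} {z : E} {r : ℝ} (hF : HasFDerivAt F D z) (hr : 0 < r)
    (h : ∀ z', P z' → ‖z' - z‖ < r → F z ≤ F z') :
    ∀ ε > (0 : ℝ), ∃ δ > (0 : ℝ), ∀ z', P z' → ‖z' - z‖ < δ →
      -D (z' - z) ≤ ε * ‖z' - z‖ := by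
  intro ε hε
  obtain ⟨δ, hδ, hlo⟩ := Metric.eventually_nhds_iff.1 (hF.isLittleO.def hε)
  refine ⟨min r δ, by positivity, fun z' hz' hzd => ?_⟩
  have h1 := le_of_abs_le
    (hlo (y := z') (by rw [dist_eq_norm]; exact hzd.trans_le (min_le_right _ _)))
  have h2 := h z' hz' (hzd.trans_le (min_le_left _ _))
  linarith

theorem exists_multiplier_of_min {n m p : ℕ} {φ : Eu n × Eu m → Eu m} {G : Eu n × Eu m → Eu p}
    (hφ : ContDiff ℝ 1 φ) (hG : ContDiff ℝ 1 G) {zb z z₀ : Eu n × Eu m} {y' ys : Eu m}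
    {κ δ ν r c Λ ε : ℝ} (hκ : 0 < κ)
    (hnear : ∀ z, ‖z - zb‖ < δ →
      ∃ z', (∀ j, G z' j ≤ 0) ∧ ‖z' - z‖ ≤ κ * ∑ j, max (G z j) 0)
    (hzδ : ‖z - zb‖ < δ) (hz : ∀ j, G z j ≤ 0) (hν : 0 < ν) (hr : 0 < r) (hc : 0 ≤ c)
    (ha : ‖z.2 - y'‖ ≤ ν) (hb : ‖φ z + ys‖ ≤ ν) (hΛ : ‖fderiv ℝ φ z‖ ≤ Λ)
    (hcε : 4 * c * ‖z - z₀‖ ≤ ε)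
    (h : ∀ z', (∀ j, G z' j ≤ 0) → ‖z' - z‖ < r →
      ‖z.2 - y'‖ ^ 2 + ‖φ z + ys‖ ^ 2 +
          2 * ν * c * (‖z.1 - z₀.1‖ ^ 2 + ‖z.2 - z₀.2‖ ^ 2) ≤
        ‖z'.2 - y'‖ ^ 2 + ‖φ z' + ys‖ ^ 2 +
          2 * ν * c * (‖z'.1 - z₀.1‖ ^ 2 + ‖z'.2 - z₀.2‖ ^ 2)) :
    ∃ η : Eu p, (∀ j, 0 ≤ η j ∧ η j ≤ κ * (1 + Λ + ε)) ∧ (∀ j, G z j ≠ 0 → η j = 0) ∧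
      ∀ d, |⟪ν⁻¹ • (z.2 - y'), d.2⟫ - ⟪-(ν⁻¹ • (φ z + ys)), fderiv ℝ φ z d⟫ +
        ⟪η, fderiv ℝ G z d⟫| ≤ ε * ‖d‖ := by
  have hφd := (hφ.differentiable (by norm_num) z).hasFDerivAt
  have hfst : HasFDerivAt (fun x : Eu n × Eu m => x.1) (ContinuousLinearMap.fst ℝ _ _) z :=
    hasFDerivAt_fst
  have hsnd : HasFDerivAt (fun x : Eu n × Eu m => x.2) (ContinuousLinearMap.snd ℝ _ _) z :=
    hasFDerivAt_snd
  have hder := (((hsnd.sub_const y').norm_sq.add (hφd.add_const ys).norm_sq).add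
    (((hfst.sub_const z₀.1).norm_sq.add (hsnd.sub_const z₀.2).norm_sq).const_mul (2 * ν * c)))
  obtain ⟨D, hD, hDd⟩ : ∃ D : Eu n × Eu m →L[ℝ] ℝ, HasFDerivAt
      (fun x : Eu n × Eu m => ‖x.2 - y'‖ ^ 2 + ‖φ x + ys‖ ^ 2 +
        2 * ν * c * (‖x.1 - z₀.1‖ ^ 2 + ‖x.2 - z₀.2‖ ^ 2)) D z ∧
      ∀ d, D d = 2 * (⟪z.2 - y', d.2⟫ + ⟪φ z + ys, fderiv ℝ φ z d⟫ +
        2 * ν * c * (⟪z.1 - z₀.1, d.1⟫ + ⟪z.2 - z₀.2, d.2⟫)) := by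
    refine ⟨_, hder, fun d => ?_⟩
    simp only [smul_apply, add_apply, smul_eq_mul, nsmul_eq_mul,
      ContinuousLinearMap.comp_apply, innerSL_apply_apply,
      ContinuousLinearMap.coe_fst', ContinuousLinearMap.coe_snd']
    push_cast
    ring
  have hreg := neg_apply_le_of_min (P := fun z => ∀ j, G z j ≤ 0) hD hr h
  set ℓ := -((2 * ν)⁻¹ • D) with hℓ
  have hℓd : ∀ d, ℓ d = -(ν⁻¹ * ⟪z.2 - y', d.2⟫ + ν⁻¹ * ⟪φ z + ys, fderiv ℝ φ z d⟫ +
      2 * c * (⟪z.1 - z₀.1, d.1⟫ + ⟪z.2 - z₀.2, d.2⟫)) := fun d => by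
    simp only [hℓ, neg_apply, smul_apply, hDd, smul_eq_mul]
    field_simp
  have hpen : ∀ d : Eu n × Eu m, |2 * c * (⟪z.1 - z₀.1, d.1⟫ + ⟪z.2 - z₀.2, d.2⟫)| ≤
      ε * ‖d‖ := fun d => by
    have h1 : |⟪z.1 - z₀.1, d.1⟫| ≤ ‖z - z₀‖ * ‖d‖ := (abs_real_inner_le_norm _ _).trans
      (mul_le_mul (norm_fst_le (z - z₀)) (norm_fst_le d) (norm_nonneg _) (norm_nonneg _))
    have h2 : |⟪z.2 - z₀.2, d.2⟫| ≤ ‖z - z₀‖ * ‖d‖ := (abs_real_inner_le_norm _ _).trans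
      (mul_le_mul (norm_snd_le (z - z₀)) (norm_snd_le d) (norm_nonneg _) (norm_nonneg _))
    rw [abs_mul, abs_of_nonneg (by positivity : 0 ≤ 2 * c)]
    have h3 := mul_le_mul_of_nonneg_left ((abs_add_le _ _).trans (add_le_add h1 h2))
      (by positivity : 0 ≤ 2 * c)
    have h4 := mul_le_mul_of_nonneg_right hcε (norm_nonneg d)
    linarith
  have hε0 : 0 ≤ ε := le_trans (by positivity) hcε
  have hΛ0 : 0 ≤ Λ := (norm_nonneg _).trans hΛ
  have hℓn : ‖ℓ‖ ≤ 1 + Λ + ε := by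
    refine ContinuousLinearMap.opNorm_le_bound _ (by positivity) fun d => ?_
    have h1 : |⟪z.2 - y', d.2⟫| ≤ ν * ‖d‖ := (abs_real_inner_le_norm _ _).trans
      (mul_le_mul ha (norm_snd_le d) (norm_nonneg _) hν.le)
    have h2 : |⟪φ z + ys, fderiv ℝ φ z d⟫| ≤ ν * (Λ * ‖d‖) := (abs_real_inner_le_norm _ _).trans
      (mul_le_mul hb ((fderiv ℝ φ z).le_of_opNorm_le hΛ d) (norm_nonneg _) hν.le)
    rw [hℓd, norm_neg, Real.norm_eq_abs]
    refine (abs_add_le _ _).trans ((add_le_add_left (abs_add_le _ _) _).trans ?_)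
    have h3 := hpen d
    rw [abs_mul, abs_mul, abs_of_pos (inv_pos.2 hν)]
    have h4 := mul_le_mul_of_nonneg_left h1 (inv_pos.2 hν).le
    have h5 := mul_le_mul_of_nonneg_left h2 (inv_pos.2 hν).le
    rw [inv_mul_cancel_left₀ hν.ne'] at h4 h5
    linarith
  obtain ⟨η, h1, h2, h3⟩ := exists_multiplier_of_regular_normal hκ hnear hzδ hz
    (hG.differentiable (by norm_num) z).hasFDerivAt ℓ (fun θ hθ => by
      obtain ⟨δ', hδ', hreg⟩ := hreg (2 * ν * θ) (by positivity)
      refine ⟨δ', hδ', fun z' hz' hzd => ?_⟩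
      have := mul_le_mul_of_nonneg_left (hreg z' hz' hzd) (by positivity : 0 ≤ (2 * ν)⁻¹)
      rw [mul_assoc (2 * ν), inv_mul_cancel_left₀ (by positivity)] at this
      rw [hℓ, neg_apply, smul_apply, smul_eq_mul]
      linarith)
  refine ⟨η, fun j => ⟨(h1 j).1, (h1 j).2.trans (by gcongr)⟩, h2, fun d => ?_⟩
  rw [← h3, hℓd, real_inner_smul_left, inner_neg_left, real_inner_smul_left]
  have := hpen d
  rw [← abs_neg] at this
  convert this using 2
  ring

theorem exists_isApproxStationary {n m p q : ℕ} {φ : Eu n × Eu m → Eu m}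
    {G : Eu n × Eu m → Eu p} {g : Eu m → Eu q} (hφ : ContDiff ℝ 1 φ) (hG : ContDiff ℝ 1 G)
    (hg : ContDiff ℝ 1 g) {zb : Eu n × Eu m} (hzb : zb ∈ mpecSol φ G g) {κ δ κ' δ' : ℝ}
    (hκ : 0 < κ) (hδ : 0 < δ)
    (hnear : ∀ z, ‖z - zb‖ < δ →
      ∃ z', (∀ j, G z' j ≤ 0) ∧ ‖z' - z‖ ≤ κ * ∑ j, max (G z j) 0)
    (hκ' : 0 < κ') (hδ' : 0 < δ')
    (hnear' : ∀ z, ‖z - zb.2‖ < δ' →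
      ∃ z', (∀ j, g z' j ≤ 0) ∧ ‖z' - z‖ ≤ κ' * ∑ j, max (g z j) 0)
    (hnot : ¬ msr (fun z : Eu n × Eu m => {w : Eu m × Eu p |
      (z.2 ∈ Gam g ∧ w.1 - φ z ∈ rnc (Gam g) z.2) ∧ ∀ j, G z j - w.2 j ≤ 0}) zb (0, 0))
    {ε : ℝ} (hε : 0 < ε) (hε1 : ε ≤ 1) :
    ∃ z y' ys α w η,
      IsApproxStationary φ G g zb (κ * (‖fderiv ℝ φ zb‖ + 3)) ε z y' ys α w η := by
  obtain ⟨R₀, hR₀, hbd, hlip⟩ := exists_fderiv_bound hφ zb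
  set Λ := ‖fderiv ℝ φ zb‖ + 1 with hΛ
  have hΛ0 : 0 < Λ := by positivity
  set R := min (min (δ / 2) (δ' / 2)) (min (min (ε / 2) (R₀ / 2)) (min (1 / 4) (1 / (4 * Λ))))
    with hR
  have hR0 : 0 < R := by positivity
  have hRδ : R < δ := lt_of_le_of_lt
    ((min_le_left _ _).trans (min_le_left _ _)) (half_lt_self hδ)
  have hRδ' : R < δ' := lt_of_le_of_lt
    ((min_le_left _ _).trans (min_le_right _ _)) (half_lt_self hδ')
  have hRε : R < ε := lt_of_le_of_lt
    ((min_le_right _ _).trans ((min_le_left _ _).trans (min_le_left _ _))) (half_lt_self hε)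
  have hRR₀ : R < R₀ := lt_of_le_of_lt
    ((min_le_right _ _).trans ((min_le_left _ _).trans (min_le_right _ _))) (half_lt_self hR₀)
  have hR4 : R ≤ 1 / 4 :=
    (min_le_right _ _).trans ((min_le_right _ _).trans (min_le_left _ _))
  have hRΛ : Λ * R ≤ 1 / 4 := by
    have : R ≤ 1 / (4 * Λ) :=
      (min_le_right _ _).trans ((min_le_right _ _).trans (min_le_right _ _))
    rw [le_div_iff₀ (by positivity)] at this
    linarith
  clear_value R
  set K := 8 / ε with hK
  have hK8 : 8 ≤ K := by rw [hK, le_div_iff₀ hε]; linarith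
  have hKε : K * ε = 8 := by rw [hK]; field_simp
  clear_value K
  obtain ⟨f, hf, z₀, y₀, ys₀, hz₀, hz₀G, hp₀, hres, hfar⟩ :=
    exists_far_quasi_solution hφ hzb hκ hδ hnear hnot (K := K) (r := R / 4) (by positivity)
      (by positivity)
  have hφR : ∀ z, ‖z - zb‖ < R → ‖φ z - φ zb‖ ≤ 1 / 4 := fun z hz => by
    refine (hlip zb z (by simpa using hR₀) (hz.trans hRR₀)).trans (le_trans ?_ hRΛ)
    gcongr
  have hKf : K * f < R / 4 := (hfar zb hzb).trans_lt hz₀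
  have hfR : f ≤ R / 32 := by nlinarith
  set N : (Eu n × Eu m) × (Eu m × Eu m) → ℝ := fun ζ =>
    Real.sqrt (‖ζ.1.2 - ζ.2.1‖ ^ 2 + ‖φ ζ.1 + ζ.2.2‖ ^ 2) with hN
  have hNsq : ∀ ζ, N ζ ^ 2 = ‖ζ.1.2 - ζ.2.1‖ ^ 2 + ‖φ ζ.1 + ζ.2.2‖ ^ 2 := fun ζ =>
    Real.sq_sqrt (by positivity)
  have hN0 : ∀ ζ, 0 ≤ N ζ := fun ζ => Real.sqrt_nonneg _
  set c := 4 * f / (K * f) ^ 2 with hc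
  have hc0 : 0 < c := by positivity
  have hcK : c * (K * f) ^ 2 = 4 * f := by rw [hc]; field_simp
  clear_value c
  set e : Eu n × Eu m → ℝ := fun z => ‖z.1 - z₀.1‖ ^ 2 + ‖z.2 - z₀.2‖ ^ 2 with he
  have he0 : ∀ z, 0 ≤ e z := fun z => by positivity
  have hez : ∀ z, ‖z - z₀‖ ^ 2 ≤ e z := fun z => by
    rcases max_cases ‖(z - z₀).1‖ ‖(z - z₀).2‖ with h | h
    · rw [Prod.norm_def, h.1]
      exact le_add_of_nonneg_right (by positivity)
    · rw [Prod.norm_def, h.1]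
      exact le_add_of_nonneg_left (by positivity)
  set T := {z : Eu n × Eu m | (∀ j, G z j ≤ 0) ∧ ‖z - zb‖ ≤ R} ×ˢ
    {p | p ∈ gphN g ∧ ‖p.1 - zb.2‖ ≤ R ∧ ‖p.2 + φ zb‖ ≤ 1} with hT
  have hTc : IsCompact T := by
    refine IsCompact.prod ?_ (isCompact_gphN_inter hg hκ' hnear' hRδ' _)
    have hcl : IsClosed {z : Eu n × Eu m | ∀ j, G z j ≤ 0} := by
      rw [show {z : Eu n × Eu m | ∀ j, G z j ≤ 0} = ⋂ j, {z | G z j ≤ 0} by ext; simp]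
      have := hG.continuous
      exact isClosed_iInter fun j => isClosed_le (by fun_prop) continuous_const
    have h := (isCompact_closedBall zb R).inter_left hcl
    have e : {z : Eu n × Eu m | (∀ j, G z j ≤ 0) ∧ ‖z - zb‖ ≤ R} =
        {z : Eu n × Eu m | ∀ j, G z j ≤ 0} ∩ Metric.closedBall zb R := by
      ext z
      exact and_congr Iff.rfl mem_closedBall_iff_norm.symm
    rwa [e]
  have hmemT : ∀ z y' ys, (∀ j, G z j ≤ 0) → (y', ys) ∈ gphN g → ‖z - zb‖ ≤ R / 2 →
      ‖z.2 - y'‖ ≤ R / 4 → ‖φ z + ys‖ ≤ 1 / 4 → (z, (y', ys)) ∈ T := by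
    intro z y' ys h1 h2 h3 h4 h5
    refine ⟨⟨h1, by linarith⟩, h2, ?_, ?_⟩
    · have h6 := norm_sub_le_norm_sub_add_norm_sub y' z.2 zb.2
      have h7 : ‖z.2 - zb.2‖ ≤ R / 2 := (norm_snd_le (z - zb)).trans h3
      rw [norm_sub_rev y' z.2] at h6
      change ‖y' - zb.2‖ ≤ R
      linarith
    · have h6 : ys + φ zb = (φ z + ys) - (φ z - φ zb) := by abel
      have h7 := norm_sub_le (φ z + ys) (φ z - φ zb)
      have h8 := hφR z (by linarith)
      change ‖ys + φ zb‖ ≤ 1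
      rw [h6]
      linarith
  have hNle : ∀ ζ : (Eu n × Eu m) × (Eu m × Eu m), ‖ζ.1.2 - ζ.2.1‖ ≤ N ζ ∧
      ‖φ ζ.1 + ζ.2.2‖ ≤ N ζ := fun ζ =>
    ⟨Real.le_sqrt_of_sq_le (by linarith [sq_nonneg ‖φ ζ.1 + ζ.2.2‖]),
      Real.le_sqrt_of_sq_le (by linarith [sq_nonneg ‖ζ.1.2 - ζ.2.1‖])⟩
  have hN₀ : N (z₀, (y₀, ys₀)) ≤ f := Real.sqrt_le_iff.2 ⟨hf.le, hres⟩
  have hT₀ : (z₀, (y₀, ys₀)) ∈ T := hmemT _ _ _ hz₀G hp₀ (by linarith)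
    ((hNle (z₀, (y₀, ys₀))).1.trans (by linarith))
    ((hNle (z₀, (y₀, ys₀))).2.trans (by linarith))
  obtain ⟨⟨z, y', ys⟩, hζT, hmin⟩ := hTc.exists_isMinOn ⟨_, hT₀⟩
    (f := fun ζ => N ζ + c * e ζ.1) (by have := hφ.continuous; fun_prop)
  have hmin : ∀ ζ ∈ T, N (z, y', ys) + c * e z ≤ N ζ + c * e ζ.1 := fun ζ hζ => hmin hζ
  have hle₀ : N (z, y', ys) + c * e z ≤ f := by
    have h1 := hmin _ hT₀
    have h2 : e z₀ = 0 := by simp [he]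
    rw [h2] at h1
    linarith
  have hNf : N (z, y', ys) ≤ f := by linarith [mul_nonneg hc0.le (he0 z)]
  have hzz₀ : ‖z - z₀‖ ≤ K * f / 2 := by
    have h1 : c * ‖z - z₀‖ ^ 2 ≤ c * (K * f / 2) ^ 2 := by
      have := mul_le_mul_of_nonneg_left (hez z) hc0.le
      have := hN0 (z, y', ys)
      linarith
    exact le_of_sq_le_sq (le_of_mul_le_mul_left h1 hc0) (by positivity)
  set t := ‖z - zb‖ with ht
  have htR : t < R / 2 := by
    have := norm_sub_le_norm_sub_add_norm_sub z z₀ zb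
    linarith
  have htK : K * f / 2 ≤ t := by
    have h1 := norm_sub_le_norm_sub_add_norm_sub z₀ z zb
    rw [norm_sub_rev z₀ z] at h1
    linarith [hfar zb hzb]
  have hft : f ≤ ε * t := by nlinarith
  obtain ⟨⟨hzG, -⟩, hpm, -, -⟩ := hζT
  have hpm : (y', ys) ∈ gphN g := hpm
  have hNpos : 0 < N (z, y', ys) := by
    refine (hN0 _).lt_of_ne fun h0 => ?_
    have h1 := (hNle (z, y', ys)).1
    have h2 := (hNle (z, y', ys)).2
    rw [← h0] at h1 h2
    have h3 : z.2 = y' := sub_eq_zero.1 (norm_le_zero_iff.1 h1)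
    have h4 : -φ z = ys := neg_eq_of_add_eq_zero_right (norm_le_zero_iff.1 h2)
    have h5 := hfar z ⟨by rw [h3, h4]; exact hpm, hzG⟩
    rw [norm_sub_rev] at h5
    have : 0 < K * f := by positivity
    linarith
  set ν := N (z, y', ys) with hν
  have hνsq := hNsq (z, y', ys)
  rw [← hν] at hνsq
  simp only at hνsq
  set a := z.2 - y' with ha
  set b := φ z + ys with hb
  have hsmooth : ∀ ζ ∈ T, ν ^ 2 + 2 * ν * c * e z ≤
      ‖ζ.1.2 - ζ.2.1‖ ^ 2 + ‖φ ζ.1 + ζ.2.2‖ ^ 2 + 2 * ν * c * e ζ.1 := fun ζ hζ => by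
    have h1 := mul_le_mul_of_nonneg_left (hmin ζ hζ) hNpos.le
    have h2 := hNsq ζ
    linarith [sq_nonneg (N ζ - ν)]
  have hζT : (z, (y', ys)) ∈ T := hmemT _ _ _ hzG hpm htR.le
    ((hNle (z, (y', ys))).1.trans (by linarith)) ((hNle (z, (y', ys))).2.trans (by linarith))
  have hcε : 4 * c * ‖z - z₀‖ ≤ ε := by
    have h1 := mul_le_mul_of_nonneg_left hzz₀ (by positivity : 0 ≤ 4 * c)
    have h2 : 4 * c * (K * f / 2) ≤ ε := by
      have h3 : 4 * c * (K * f / 2) * (K * f) = ε * (K * f) := by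
        have : ε * (K * f) = 8 * f := by rw [← hKε]; ring
        rw [this]
        linarith
      exact (mul_right_cancel₀ (by positivity) h3).le
    linarith
  obtain ⟨η, hη1, hη2, hη3⟩ := exists_multiplier_of_min (ε := ε) (r := R / 4) (ν := ν) (c := c)
    (Λ := Λ) (z₀ := z₀) (y' := y') (ys := ys) (z := z)
    hφ hG hκ hnear (by linarith) hzG hNpos (by positivity) hc0.le (hNle (z, (y', ys))).1
    (hNle (z, (y', ys))).2 (hbd z (by linarith)) hcε (fun z' hz'G hz' => by
      have h1 : (z', (y', ys)) ∈ T := by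
        refine ⟨⟨hz'G, ?_⟩, hζT.2⟩
        have := norm_sub_le_norm_sub_add_norm_sub z' z zb
        linarith
      have h2 := hsmooth _ h1
      rw [hνsq] at h2
      exact h2)
  refine ⟨z, y', ys, ν⁻¹ • a, -(ν⁻¹ • b), η, hzG, hpm, ?_, by linarith,
    (hNle (z, (y', ys))).1.trans (hNf.trans hft), (hNle (z, (y', ys))).2.trans (hNf.trans hft),
    ?_, ?_, fun j => (hη1 j).1, fun j => (hη1 j).2.trans ?_, hη2, hη3⟩
  · have : 0 < K * f := by positivity
    linarith
  · rw [norm_neg, norm_smul, norm_smul, mul_pow, mul_pow, ← mul_add, ← hνsq, norm_inv,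
      Real.norm_of_nonneg hNpos.le, inv_pow, inv_mul_cancel₀ (by positivity)]
  · refine regular_normal_of_min (p₀ := (y', ys)) (r := R / 4) hNpos (by positivity)
      fun p hp hpd => ?_
    have h1 := norm_fst_le (p - (y', ys))
    have h2 := norm_snd_le (p - (y', ys))
    have h3 : (z, p) ∈ T := by
      refine ⟨hζT.1, hp, ?_, ?_⟩
      · have h4 := norm_sub_le_norm_sub_add_norm_sub p.1 y' zb.2
        have h5 := norm_sub_le_norm_sub_add_norm_sub y' z.2 zb.2
        have h6 : ‖z.2 - zb.2‖ ≤ t := norm_snd_le (z - zb)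
        have h7 := (hNle (z, (y', ys))).1
        rw [norm_sub_rev y' z.2] at h5
        simp only [Prod.fst_sub] at h1 h7
        change ‖p.1 - zb.2‖ ≤ R
        linarith
      · have h4 : p.2 + φ zb = (φ z + ys) + (p.2 - ys) - (φ z - φ zb) := by abel
        have h5 := norm_sub_le (φ z + ys + (p.2 - ys)) (φ z - φ zb)
        have h6 := norm_add_le (φ z + ys) (p.2 - ys)
        have h7 := (hNle (z, (y', ys))).2
        have h8 := hφR z (by linarith)
        simp only [Prod.snd_sub] at h2 h7
        change ‖p.2 + φ zb‖ ≤ 1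
        rw [h4]
        linarith
    have h4 := hsmooth _ h3
    have h5 : a - (p - (y', ys)).1 = z.2 - p.1 := by simp [ha]
    have h6 : b + (p - (y', ys)).2 = φ z + p.2 := by simp [hb]
    rw [h5, h6, ← hνsq]
    simp only at h4
    linarith
  · exact mul_le_mul_of_nonneg_left (by rw [hΛ]; linarith) hκ.le

/-- A nonnegative vector whose support carries no nonnegative kernel vector of `A` can be replaced,
without changing its image or increasing a linear functional, by one whose support carries no
kernel vector at all. -/
theorem exists_support_minimal {q : ℕ} {F : Type*} [AddCommGroup F] [Module ℝ F]
    (A : Eu q →ₗ[ℝ] F) (b : Eu q →ₗ[ℝ] ℝ) (l : Eu q) (hl : ∀ i, 0 ≤ l i)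
    (hp : ∀ r : Eu q, (∀ i, 0 ≤ r i) → (∀ i, l i = 0 → r i = 0) → A r = 0 → r = 0) :
    ∃ μ : Eu q, (∀ i, 0 ≤ μ i) ∧ (∀ i, l i = 0 → μ i = 0) ∧ A μ = A l ∧ b μ ≤ b l ∧
      ∀ r : Eu q, (∀ i, μ i = 0 → r i = 0) → A r = 0 → r = 0 := by
  classical
  induction hN : (Finset.univ.filter fun i => l i ≠ 0).card using Nat.strong_induction_on
    generalizing l with
  | _ N ih =>
  by_cases hind : ∀ r : Eu q, (∀ i, l i = 0 → r i = 0) → A r = 0 → r = 0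
  · exact ⟨l, hl, fun _ h => h, rfl, le_rfl, hind⟩
  push Not at hind
  have : ∃ r : Eu q, (∀ i, l i = 0 → r i = 0) ∧ A r = 0 ∧ r ≠ 0 ∧ b r ≤ 0 := by
    obtain ⟨r, h1, h2, h3⟩ := hind
    rcases le_total (b r) 0 with h | h
    · exact ⟨r, h1, h2, h3, h⟩
    · exact ⟨-r, fun i hi => by simp [h1 i hi], by simp [h2], neg_ne_zero.2 h3, by simpa using h⟩
  obtain ⟨r, hr, hAr, hr0, hbr⟩ := this
  have hneg : (Finset.univ.filter fun i => r i < 0).Nonempty := by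
    by_contra hcon
    rw [Finset.not_nonempty_iff_eq_empty, Finset.filter_eq_empty_iff] at hcon
    exact hr0 (hp r (fun i => not_lt.1 (hcon (Finset.mem_univ i))) hr hAr)
  obtain ⟨i₀, hi₀, hmin⟩ := Finset.exists_min_image _ (fun i => l i / -r i) hneg
  rw [Finset.mem_filter] at hi₀
  have hri₀ : 0 < -r i₀ := neg_pos.2 hi₀.2
  set s := l i₀ / -r i₀ with hs
  have hs0 : 0 ≤ s := div_nonneg (hl _) hri₀.le
  have hl' : ∀ i, 0 ≤ (l + s • r) i := fun i => by
    simp only [PiLp.add_apply, PiLp.smul_apply, smul_eq_mul]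
    rcases le_or_gt 0 (r i) with h | h
    · have := hl i
      positivity
    · have h1 := hmin i (by simpa using h)
      rw [le_div_iff₀ (by linarith)] at h1
      linarith
  have hsupp : ∀ i, l i = 0 → (l + s • r) i = 0 := fun i hi => by simp [hi, hr i hi]
  have hAl : A (l + s • r) = A l := by simp [hAr]
  have hbl : b (l + s • r) ≤ b l := by
    have := mul_nonneg hs0 (neg_nonneg.2 hbr)
    simp only [map_add, map_smul, smul_eq_mul]
    linarith
  have hcard : (Finset.univ.filter fun i => (l + s • r) i ≠ 0).card < N := by
    rw [← hN]
    refine Finset.card_lt_card (Finset.ssubset_iff_of_subset ?_ |>.2 ⟨i₀, ?_, ?_⟩)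
    · intro i
      simp only [Finset.mem_filter, Finset.mem_univ, true_and]
      exact mt (hsupp i)
    · simp only [Finset.mem_filter, Finset.mem_univ, true_and]
      exact fun h => hi₀.2.ne (hr _ h)
    · have : (l + s • r) i₀ = 0 := by
        rw [PiLp.add_apply, PiLp.smul_apply, smul_eq_mul, hs, div_neg, neg_mul,
          div_mul_cancel₀ _ hi₀.2.ne, add_neg_cancel]
      exact fun h => (Finset.mem_filter.1 h).2 this
  obtain ⟨μ, h1, h2, h3, h4, h5⟩ := ih _ hcard (l + s • r) hl'
    (fun r' h1 h2 h3 => hp r' h1 (fun i hi => h2 i (hsupp i hi)) h3) rfl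
  exact ⟨μ, h1, fun i hi => h2 i (hsupp i hi), h3.trans hAl, h4.trans hbl, h5⟩

/-- Near a point satisfying MSCQ there is a multiplier of least total mass, with a bound that is
linear in the normal. -/
theorem exists_minimal_mem_Lam {m q : ℕ} {g : Eu m → Eu q} {yb y ys : Eu m} {κ δ : ℝ}
    (hκ : 0 < κ) (hnear : ∀ z, ‖z - yb‖ < δ →
      ∃ z', (∀ j, g z' j ≤ 0) ∧ ‖z' - z‖ ≤ κ * ∑ j, max (g z j) 0)
    (hg : DifferentiableAt ℝ g y) (hyd : ‖y - yb‖ < δ) (hp : (y, ys) ∈ gphN g) :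
    ∃ l ∈ Lam g y ys, (∀ i, l i ≤ q * (κ * ‖ys‖)) ∧ ∀ l' ∈ Lam g y ys, ∑ i, l i ≤ ∑ i, l' i := by
  obtain ⟨l₀, hl₀, hl₀M⟩ := exists_mem_Lam_of_mem_rnc hκ hnear hg hyd hp.1 hp.2
  have hsum : ∑ i, l₀ i ≤ q * (κ * ‖ys‖) := by
    refine (Finset.sum_le_sum fun i _ => hl₀M i).trans ?_
    simp
  have hle : ∀ l ∈ Lam g y ys, ∀ i, l i ≤ ∑ i, l i := fun l hl i =>
    Finset.single_le_sum (f := fun i => l i) (fun i _ => hl.1 i) (Finset.mem_univ i)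
  obtain ⟨l, ⟨hl, hlM⟩, hmin⟩ := (isCompact_Lam_inter (g := g) y ys (q * (κ * ‖ys‖))).exists_isMinOn
    ⟨l₀, hl₀, fun i => (hle l₀ hl₀ i).trans hsum⟩
    (f := fun l : Eu q => ∑ i, l i) (by fun_prop)
  refine ⟨l, hl, hlM, fun l' hl' => ?_⟩
  by_cases h : ∀ i, l' i ≤ q * (κ * ‖ys‖)
  · exact hmin ⟨hl', h⟩
  · push Not at h
    obtain ⟨i, hi⟩ := h
    have h1 : ∑ i, l i ≤ ∑ i, l₀ i := hmin ⟨hl₀, fun i => (hle l₀ hl₀ i).trans hsum⟩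
    linarith [hle l' hl' i]

/-- The support of a limit of multipliers of least total mass carries no nontrivial nonnegative
combination of the active gradients that vanishes. -/
theorem eq_zero_of_tendsto_minimal {m q : ℕ} {g : Eu m → Eu q} (hg : ContDiff ℝ 1 g) {yb : Eu m}
    {κ δ : ℝ} (hκ : 0 < κ) (hnear : ∀ z, ‖z - yb‖ < δ →
      ∃ z', (∀ j, g z' j ≤ 0) ∧ ‖z' - z‖ ≤ κ * ∑ j, max (g z j) 0)
    {y ys : ℕ → Eu m} {l : ℕ → Eu q} {l₀ : Eu q} (hyd : ∀ k, ‖y k - yb‖ < δ)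
    (hyG : ∀ k, y k ∈ Gam g) (hl : ∀ k, l k ∈ Lam g (y k) (ys k))
    (hmin : ∀ k, ∀ l' ∈ Lam g (y k) (ys k), ∑ i, l k i ≤ ∑ i, l' i)
    (hy : Tendsto y atTop (𝓝 yb)) (hlim : Tendsto l atTop (𝓝 l₀)) {r : Eu q}
    (hr : ∀ i, 0 ≤ r i) (hsupp : ∀ i, l₀ i = 0 → r i = 0)
    (hA : ContinuousLinearMap.adjoint (fderiv ℝ g yb) r = 0) : r = 0 := by
  have hgd := hg.differentiable (by norm_num)
  have hli : ∀ i, Tendsto (fun k => l k i) atTop (𝓝 (l₀ i)) := fun i =>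
    ((by fun_prop : Continuous fun x : Eu q => x i).tendsto l₀).comp hlim
  have hl₀ : ∀ i, 0 ≤ l₀ i := fun i => ge_of_tendsto' (hli i) fun k => (hl k).1 i
  have hex : ∀ᶠ s in 𝓝[>] (0 : ℝ), ∀ i, s * r i < l₀ i ∨ r i = 0 := by
    refine eventually_all.2 fun i => ?_
    rcases (hl₀ i).eq_or_lt with h | h
    · exact .of_forall fun s => .inr (hsupp i h.symm)
    · have : Tendsto (fun s : ℝ => s * r i) (𝓝[>] 0) (𝓝 (0 * r i)) :=
        ((continuous_mul_const (r i)).tendsto 0).mono_left nhdsWithin_le_nhds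
      rw [zero_mul] at this
      exact (this.eventually_lt_const h).mono fun s hs => .inl hs
  obtain ⟨s, hs, hs0⟩ := (hex.and self_mem_nhdsWithin).exists
  have hs0 : 0 < s := hs0
  have hev : ∀ᶠ k in atTop, ∀ i, s * r i < l k i ∨ r i = 0 :=
    eventually_all.2 fun i => (hs i).elim
      (fun h => ((hli i).eventually_const_lt h).mono fun k hk => .inl hk)
      fun h => .of_forall fun k => .inr h
  have hbound : ∀ᶠ k in atTop, ∑ i, r i ≤
      q * (κ * ‖ContinuousLinearMap.adjoint (fderiv ℝ g (y k)) r‖) := by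
    filter_upwards [hev] with k hk
    have hmem : r ∈ Lam g (y k) (ContinuousLinearMap.adjoint (fderiv ℝ g (y k)) r) := by
      refine ⟨hr, rfl, fun i hi => (hk i).resolve_left fun h => ?_⟩
      rw [(hl k).2.2 i hi] at h
      exact h.not_ge (mul_nonneg hs0.le (hr i))
    obtain ⟨r', hr', hr'M⟩ := exists_mem_Lam_of_mem_rnc hκ hnear (hgd (y k)) (hyd k) (hyG k)
      (mem_rnc_of_mem_Lam (hgd (y k)) hmem)
    have hcomb : l k - s • r + s • r' ∈ Lam g (y k) (ys k) := by
      refine ⟨fun i => ?_, ?_, fun i hi => ?_⟩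
      · have h1 := mul_nonneg hs0.le (hr'.1 i)
        simp only [PiLp.add_apply, PiLp.sub_apply, PiLp.smul_apply, smul_eq_mul]
        rcases hk i with h | h
        · linarith
        · rw [h]
          linarith [(hl k).1 i]
      · simp [hr'.2.1, (hl k).2.1]
      · simp [hr'.2.2 i hi, (hl k).2.2 i hi, hmem.2.2 i hi]
    have h1 := hmin k _ hcomb
    simp only [PiLp.add_apply, PiLp.sub_apply, PiLp.smul_apply, smul_eq_mul, Finset.sum_add_distrib,
      Finset.sum_sub_distrib, ← Finset.mul_sum] at h1
    have h2 : ∑ i, r i ≤ ∑ i, r' i := le_of_mul_le_mul_left (by linarith) hs0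
    refine h2.trans ((Finset.sum_le_sum fun i _ => hr'M i).trans ?_)
    simp
  have hlimA : Tendsto (fun k => q * (κ * ‖ContinuousLinearMap.adjoint (fderiv ℝ g (y k)) r‖)) atTop
      (𝓝 (q * (κ * ‖ContinuousLinearMap.adjoint (fderiv ℝ g yb) r‖))) := by
    have hc := hg.continuous_fderiv (by norm_num)
    have h1 : Continuous fun y => ContinuousLinearMap.adjoint (fderiv ℝ g y) r :=
      ((ContinuousLinearMap.adjoint : (Eu m →L[ℝ] Eu q) ≃ₗᵢ⋆[ℝ] _).continuous.comp hc).clm_apply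
        continuous_const
    exact (((h1.tendsto yb).comp hy).norm.const_mul κ).const_mul _
  rw [hA, norm_zero, mul_zero, mul_zero] at hlimA
  have h0 := (Finset.sum_eq_zero_iff_of_nonneg fun i _ => hr i).1
    (le_antisymm (ge_of_tendsto hlimA hbound) (Finset.sum_nonneg fun i _ => hr i))
  ext i
  simpa using h0 i (Finset.mem_univ i)

/-- A multiplier complementary to `g` along a feasible sequence maximizes the second-order form in
the direction of the sequence. -/
theorem inner_fderiv_fderiv_le_of_tendsto {m q : ℕ} {g : Eu m → Eu q} (hg : ContDiff ℝ 2 g)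
    {yb ybs v : Eu m} {l l' : Eu q} (hl : l ∈ Lam g yb ybs) (hl' : l' ∈ Lam g yb ybs)
    {y : ℕ → Eu m} {t : ℕ → ℝ} (hyG : ∀ k, y k ∈ Gam g) (ht : ∀ k, 0 < t k)
    (ht0 : Tendsto t atTop (𝓝 0)) (hv : Tendsto (fun k => (t k)⁻¹ • (y k - yb)) atTop (𝓝 v))
    (hcomp : ∀ᶠ k in atTop, ⟪l, g (y k)⟫ = 0) :
    ⟪l', fderiv ℝ (fderiv ℝ g) yb v v⟫ ≤ ⟪l, fderiv ℝ (fderiv ℝ g) yb v v⟫ := by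
  set B := fderiv ℝ (fderiv ℝ g) yb with hB
  have hΔ : Tendsto (fun k => y k - yb) atTop (𝓝 0) := by
    have := ht0.smul hv
    rw [zero_smul] at this
    exact this.congr fun k => smul_inv_smul₀ (ht k).ne' _
  have hgb : ∀ l ∈ Lam g yb ybs, ⟪l, g yb⟫ = 0 := fun l hl => by
    rw [inner_eq_sum]
    refine Finset.sum_eq_zero fun i _ => ?_
    by_cases h : g yb i = 0
    · rw [h, mul_zero]
    · rw [hl.2.2 i h, zero_mul]
  have hbil : Continuous fun x : Eu m => ⟪l' - l, B x x⟫ := by fun_prop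
  have hkey : ∀ ε > (0 : ℝ), ⟪l' - l, B v v⟫ ≤ 2 * ‖l' - l‖ * (ε * ‖v‖ ^ 2) := by
    intro ε hε
    obtain ⟨δ, hδ, htay⟩ := exists_taylor_two hg yb hε
    have hsmall : ∀ᶠ k in atTop, ‖y k - yb‖ < δ := by
      have := hΔ.norm
      rw [norm_zero] at this
      exact this.eventually_lt_const hδ
    refine le_of_tendsto_of_tendsto ((hbil.tendsto v).comp hv)
      (((hv.norm.pow 2).const_mul ε).const_mul (2 * ‖l' - l‖)) ?_
    filter_upwards [hsmall, hcomp] with k hk hk0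
    set d := (t k)⁻¹ • (y k - yb) with hd
    have hyd : y k - yb = t k • d := (smul_inv_smul₀ (ht k).ne' _).symm
    have h1 := htay _ hk
    set R := g (yb + (y k - yb)) - g yb - fderiv ℝ g yb (y k - yb) -
      (1 / 2 : ℝ) • B (y k - yb) (y k - yb) with hR
    have h2 : ⟪l', g (y k)⟫ ≤ 0 := by
      rw [inner_eq_sum]
      exact Finset.sum_nonpos fun i _ => mul_nonpos_of_nonneg_of_nonpos (hl'.1 i) (hyG k i)
    have h3 : ⟪l' - l, R⟫ = ⟪l', g (y k)⟫ - (1 / 2) * (t k ^ 2 * ⟪l' - l, B d d⟫) := by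
      have h4 := (inner_eq_of_mem_Lam hl (y k - yb)).symm.trans (inner_eq_of_mem_Lam hl' (y k - yb))
      have h5 : B (y k - yb) (y k - yb) = t k ^ 2 • B d d := by
        rw [hyd]
        simp only [map_smul, smul_apply, smul_smul, sq]
      rw [hR, h5, add_sub_cancel, inner_sub_right, inner_sub_right, inner_sub_right,
        real_inner_smul_right, real_inner_smul_right]
      simp only [inner_sub_left, hgb l hl, hgb l' hl', hk0, h4]
      ring
    have h4 := neg_le_of_abs_le (abs_real_inner_le_norm (l' - l) R)
    have h5 := mul_le_mul_of_nonneg_left h1 (norm_nonneg (l' - l))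
    have h6 : ‖y k - yb‖ ^ 2 = t k ^ 2 * ‖d‖ ^ 2 := by
      rw [hyd, norm_smul, Real.norm_of_nonneg (ht k).le, mul_pow]
    rw [h6] at h5
    have h7 : 0 < t k ^ 2 := by have := ht k; positivity
    refine le_of_mul_le_mul_left ?_ h7
    simp only [Function.comp]
    nlinarith
  have hlim : Tendsto (fun ε : ℝ => 2 * ‖l' - l‖ * (ε * ‖v‖ ^ 2)) (𝓝[>] 0)
      (𝓝 (2 * ‖l' - l‖ * (0 * ‖v‖ ^ 2))) :=
    ((by fun_prop : Continuous fun ε : ℝ => 2 * ‖l' - l‖ * (ε * ‖v‖ ^ 2)).tendsto 0).mono_left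
      nhdsWithin_le_nhds
  rw [zero_mul, mul_zero] at hlim
  have := ge_of_tendsto hlim (eventually_nhdsWithin_of_forall fun ε hε => hkey ε hε)
  rw [inner_sub_left] at this
  linarith

theorem tendsto_slope_of_tendsto {E F : Type*} [NormedAddCommGroup E] [NormedSpace ℝ E]
    [NormedAddCommGroup F] [NormedSpace ℝ F] {f : E → F} {f' : E →L[ℝ] F} {x d : E}
    (hf : HasFDerivAt f f' x) {z : ℕ → E} (hz : Tendsto z atTop (𝓝 x)) {c : ℕ → ℝ}
    (hd : Tendsto (fun k => c k • (z k - x)) atTop (𝓝 d)) :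
    Tendsto (fun k => c k • (f (z k) - f x)) atTop (𝓝 (f' d)) := by
  have := hf.hasFDerivWithinAt (s := univ) |>.lim (d := fun k => z k - x) (c := c)
    (by simpa using hz.sub_const x) (by simp) hd
  simpa using this

theorem tendsto_zero_of_norm_le {E : Type*} [NormedAddCommGroup E] {x : ℕ → E} {ε t : ℕ → ℝ}
    (hx : ∀ k, ‖x k‖ ≤ ε k * t k) (hε : Tendsto ε atTop (𝓝 0)) (ht : Tendsto t atTop (𝓝 0)) :
    Tendsto x atTop (𝓝 0) :=
  squeeze_zero_norm hx (by simpa using hε.mul ht)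

theorem tendsto_inv_smul_zero {E : Type*} [NormedAddCommGroup E] [NormedSpace ℝ E] {x : ℕ → E}
    {ε t : ℕ → ℝ} (ht : ∀ k, 0 < t k) (hx : ∀ k, ‖x k‖ ≤ ε k * t k)
    (hε : Tendsto ε atTop (𝓝 0)) : Tendsto (fun k => (t k)⁻¹ • x k) atTop (𝓝 0) :=
  squeeze_zero_norm (fun k => by
    rw [norm_smul, norm_inv, Real.norm_of_nonneg (ht k).le, inv_mul_le_iff₀ (ht k), mul_comm]
    exact hx k) hε

section Limits

variable {n m p q : ℕ} {φ : Eu n × Eu m → Eu m} {G : Eu n × Eu m → Eu p} {g : Eu m → Eu q}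
  {zb : Eu n × Eu m} {C : ℝ} {ε : ℕ → ℝ} {z : ℕ → Eu n × Eu m} {y' ys α w : ℕ → Eu m}
  {η : ℕ → Eu p}

theorem tendsto_of_isApproxStationary
    (h : ∀ k, IsApproxStationary φ G g zb C (ε k) (z k) (y' k) (ys k) (α k) (w k) (η k))
    (hε : Tendsto ε atTop (𝓝 0)) :
    Tendsto (fun k => ‖z k - zb‖) atTop (𝓝 0) ∧ Tendsto z atTop (𝓝 zb) ∧
      Tendsto y' atTop (𝓝 zb.2) := by
  have ht : Tendsto (fun k => ‖z k - zb‖) atTop (𝓝 0) :=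
    squeeze_zero (fun k => norm_nonneg _) (fun k => (h k).lt.le) hε
  have hz : Tendsto z atTop (𝓝 zb) := tendsto_iff_norm_sub_tendsto_zero.2 ht
  refine ⟨ht, hz, ?_⟩
  have h1 := tendsto_zero_of_norm_le (fun k => (h k).dist_le) hε ht
  simpa using ((continuous_snd.tendsto zb).comp hz).sub h1

theorem tendsto_normal_of_isApproxStationary (hφ : Continuous φ)
    (h : ∀ k, IsApproxStationary φ G g zb C (ε k) (z k) (y' k) (ys k) (α k) (w k) (η k))
    (hε : Tendsto ε atTop (𝓝 0)) : Tendsto ys atTop (𝓝 (-φ zb)) := by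
  obtain ⟨ht, hz, -⟩ := tendsto_of_isApproxStationary h hε
  have h1 := tendsto_zero_of_norm_le (fun k => (h k).residual_le) hε ht
  simpa using h1.sub ((hφ.tendsto zb).comp hz)

theorem exists_limit_of_isApproxStationary (hφ : Continuous φ) (hg : Differentiable ℝ g)
    {κ δ : ℝ} (hκ : 0 < κ) (hδ : 0 < δ)
    (hnear : ∀ y, ‖y - zb.2‖ < δ →
      ∃ y', (∀ j, g y' j ≤ 0) ∧ ‖y' - y‖ ≤ κ * ∑ j, max (g y j) 0)
    (h : ∀ ε > (0 : ℝ), ε ≤ 1 →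
      ∃ z y' ys α w η, IsApproxStationary φ G g zb C ε z y' ys α w η) :
    ∃ (ε : ℕ → ℝ) (z : ℕ → Eu n × Eu m) (y' ys α w : ℕ → Eu m) (η : ℕ → Eu p) (l : ℕ → Eu q)
      (d : Eu n × Eu m) (α₀ w₀ : Eu m) (η₀ : Eu p) (l₀ : Eu q),
      Tendsto ε atTop (𝓝 0) ∧
      (∀ k, IsApproxStationary φ G g zb C (ε k) (z k) (y' k) (ys k) (α k) (w k) (η k)) ∧
      (∀ k, ‖y' k - zb.2‖ < δ) ∧ (∀ k, l k ∈ Lam g (y' k) (ys k)) ∧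
      (∀ k, ∀ l' ∈ Lam g (y' k) (ys k), ∑ i, l k i ≤ ∑ i, l' i) ∧
      Tendsto (fun k => ‖z k - zb‖⁻¹ • (z k - zb)) atTop (𝓝 d) ∧ Tendsto α atTop (𝓝 α₀) ∧
      Tendsto w atTop (𝓝 w₀) ∧ Tendsto η atTop (𝓝 η₀) ∧ Tendsto l atTop (𝓝 l₀) := by
  have hpos : ∀ k : ℕ, (0 : ℝ) < 1 / ((k : ℝ) + 1) := fun k => Nat.one_div_pos_of_nat
  have hle : ∀ k : ℕ, (1 : ℝ) / ((k : ℝ) + 1) ≤ 1 := fun k => by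
    rw [div_le_one (by positivity)]
    linarith [(k.cast_nonneg : (0 : ℝ) ≤ k)]
  have hlim : Tendsto (fun k : ℕ => min 1 (δ / 2) * (1 / ((k : ℝ) + 1))) atTop (𝓝 0) := by
    simpa using tendsto_one_div_add_atTop_nhds_zero_nat.const_mul (min 1 (δ / 2))
  have hmul : ∀ k : ℕ, min 1 (δ / 2) * (1 / ((k : ℝ) + 1)) ≤ min 1 (δ / 2) := fun k =>
    mul_le_of_le_one_right (by positivity) (hle k)
  choose z y' ys α w η hst using fun k : ℕ =>
    h (min 1 (δ / 2) * (1 / ((k : ℝ) + 1))) (mul_pos (by positivity) (hpos k))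
      ((hmul k).trans (min_le_left _ _))
  have hyd : ∀ k, ‖y' k - zb.2‖ < δ := fun k => by
    have h1 := norm_sub_le_norm_sub_add_norm_sub (y' k) (z k).2 zb.2
    rw [norm_sub_rev (y' k) (z k).2] at h1
    have h2 : ‖(z k).2 - zb.2‖ ≤ ‖z k - zb‖ := norm_snd_le (z k - zb)
    have h3 := (hst k).dist_le.trans (mul_le_of_le_one_left (norm_nonneg _)
      ((hmul k).trans (min_le_left _ _)))
    have h4 := (hst k).lt.trans_le ((hmul k).trans (min_le_right _ _))
    linarith
  choose l hl hlM hmin using fun k => exists_minimal_mem_Lam hκ hnear (hg _) (hyd k)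
    (hst k).mem_gphN
  obtain ⟨S, hS⟩ := (Metric.isBounded_range_of_tendsto _
    (tendsto_normal_of_isApproxStationary hφ hst hlim)).exists_norm_le
  have hbd : ∀ k, (‖z k - zb‖⁻¹ • (z k - zb), α k, w k, η k, l k) ∈
      Metric.closedBall (0 : (Eu n × Eu m) × Eu m × Eu m × Eu p × Eu q)
        (max (max 1 (p * C)) (q * (q * (κ * S)))) := fun k => by
    have hu := (hst k).unit
    have h1 : ‖‖z k - zb‖⁻¹ • (z k - zb)‖ ≤ 1 := by
      rw [norm_smul, norm_inv, norm_norm, inv_mul_cancel₀ (hst k).pos.ne']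
    have h2 : ‖α k‖ ≤ 1 := by nlinarith [sq_nonneg ‖w k‖, norm_nonneg (α k)]
    have h3 : ‖w k‖ ≤ 1 := by nlinarith [sq_nonneg ‖α k‖, norm_nonneg (w k)]
    have h4 : ‖η k‖ ≤ p * C := by
      refine (norm_le_sum_of_nonneg (hst k).mult_nonneg).trans
        ((Finset.sum_le_sum fun j _ => (hst k).mult_le j).trans ?_)
      simp
    have h5 : ‖l k‖ ≤ q * (q * (κ * S)) := by
      refine (norm_le_sum_of_nonneg (hl k).1).trans
        ((Finset.sum_le_sum fun j _ => hlM k j).trans ?_)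
      have := hS _ (mem_range_self k)
      simp only [Finset.sum_const, Finset.card_univ, Fintype.card_fin, nsmul_eq_mul]
      gcongr
    rw [mem_closedBall_zero_iff]
    exact norm_prod_le_iff.2 ⟨h1.trans (by simp), norm_prod_le_iff.2 ⟨h2.trans (by simp),
      norm_prod_le_iff.2 ⟨h3.trans (by simp), norm_prod_le_iff.2 ⟨h4.trans (by simp),
        h5.trans (le_max_right _ _)⟩⟩⟩⟩
  obtain ⟨⟨d, α₀, w₀, η₀, l₀⟩, -, ψ, hψ, hconv⟩ :=
    (isCompact_closedBall _ _).tendsto_subseq hbd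
  have hψ' := hψ.tendsto_atTop
  have h1 := ((continuous_fst.tendsto _).comp hconv)
  have h2 := ((continuous_snd.tendsto _).comp hconv)
  have h3 := ((continuous_snd.tendsto _).comp h2)
  have h4 := ((continuous_snd.tendsto _).comp h3)
  exact ⟨_, z ∘ ψ, y' ∘ ψ, ys ∘ ψ, α ∘ ψ, w ∘ ψ, η ∘ ψ, l ∘ ψ, d, α₀, w₀, η₀, l₀,
    hlim.comp hψ', fun k => hst (ψ k), fun k => hyd (ψ k), fun k => hl (ψ k),
    fun k => hmin (ψ k), h1, (continuous_fst.tendsto _).comp h2, (continuous_fst.tendsto _).comp h3,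
    (continuous_fst.tendsto _).comp h4, (continuous_snd.tendsto _).comp h4⟩

theorem first_order_limit (hφ : ContDiff ℝ 1 φ) (hG : ContDiff ℝ 1 G)
    (h : ∀ k, IsApproxStationary φ G g zb C (ε k) (z k) (y' k) (ys k) (α k) (w k) (η k))
    (hε : Tendsto ε atTop (𝓝 0)) {d : Eu n × Eu m} {α₀ w₀ : Eu m} {η₀ : Eu p}
    (hd : Tendsto (fun k => ‖z k - zb‖⁻¹ • (z k - zb)) atTop (𝓝 d))
    (hα : Tendsto α atTop (𝓝 α₀)) (hw : Tendsto w atTop (𝓝 w₀)) (hη : Tendsto η atTop (𝓝 η₀)) :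
    ‖d‖ = 1 ∧ ‖α₀‖ ^ 2 + ‖w₀‖ ^ 2 = 1 ∧
      (∀ j, G zb j = 0 → fderiv ℝ G zb d j ≤ 0) ∧
      (∀ j, 0 ≤ η₀ j) ∧ (∀ j, G zb j ≠ 0 → η₀ j = 0) ∧ ⟪η₀, fderiv ℝ G zb d⟫ = 0 ∧
      ∀ e, ⟪α₀, e.2⟫ - ⟪w₀, fderiv ℝ φ zb e⟫ + ⟪η₀, fderiv ℝ G zb e⟫ = 0 := by
  obtain ⟨ht, hz, -⟩ := tendsto_of_isApproxStationary h hε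
  have hGd := (hG.differentiable (by norm_num) zb).hasFDerivAt
  have hslope := tendsto_slope_of_tendsto hGd hz hd
  have hcoord : ∀ j, Continuous fun x : Eu p => x j := fun j => by fun_prop
  have hslopej : ∀ j, Tendsto (fun k => ‖z k - zb‖⁻¹ * (G (z k) j - G zb j)) atTop
      (𝓝 (fderiv ℝ G zb d j)) := fun j => ((hcoord j).tendsto _).comp hslope
  have hηj : ∀ j, Tendsto (fun k => η k j) atTop (𝓝 (η₀ j)) := fun j =>
    ((hcoord j).tendsto _).comp hη
  have hGj : ∀ j, Tendsto (fun k => G (z k) j) atTop (𝓝 (G zb j)) := fun j =>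
    (((hcoord j).comp hG.continuous).tendsto _).comp hz
  have hact : ∀ j, η₀ j ≠ 0 → ∀ᶠ k in atTop, G (z k) j = 0 := fun j hj =>
    ((hηj j).eventually_ne hj).mono fun k hk => by
      by_contra hcon
      exact hk ((h k).mult_compl j hcon)
  have hcompl : ∀ j, G zb j ≠ 0 → η₀ j = 0 := fun j hj => by
    by_contra hcon
    obtain ⟨k, hk1, hk2⟩ := ((hact j hcon).and ((hGj j).eventually_ne hj)).exists
    exact hk2 hk1
  refine ⟨?_, ?_, fun j hj => ?_, fun j => ge_of_tendsto' (hηj j) fun k => (h k).mult_nonneg j,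
    hcompl, ?_, fun e => ?_⟩
  · refine tendsto_nhds_unique hd.norm (tendsto_const_nhds.congr fun k => ?_)
    rw [norm_smul, norm_inv, norm_norm, inv_mul_cancel₀ (h k).pos.ne']
  · exact tendsto_nhds_unique ((hα.norm.pow 2).add (hw.norm.pow 2))
      (tendsto_const_nhds.congr fun k => ((h k).unit).symm)
  · refine le_of_tendsto' (hslopej j) fun k => ?_
    rw [hj, sub_zero]
    exact mul_nonpos_of_nonneg_of_nonpos (by positivity) ((h k).nonpos j)
  · rw [inner_eq_sum]
    refine Finset.sum_eq_zero fun j _ => ?_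
    by_cases hj : η₀ j = 0
    · rw [hj, zero_mul]
    · have h0 : G zb j = 0 := by
        by_contra hcon
        exact hj (hcompl j hcon)
      have : fderiv ℝ G zb d j = 0 := tendsto_nhds_unique (hslopej j)
        (tendsto_const_nhds.congr' ((hact j hj).mono fun k hk => by simp [hk, h0]))
      rw [this, mul_zero]
  · have hcφ := (hφ.continuous_fderiv (by norm_num)).clm_apply (continuous_const (y := e))
    have hcG := (hG.continuous_fderiv (by norm_num)).clm_apply (continuous_const (y := e))
    have h1 := ((hα.inner (𝕜 := ℝ) (tendsto_const_nhds (x := e.2))).sub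
      (hw.inner (𝕜 := ℝ) ((hcφ.tendsto zb).comp hz))).add
      (hη.inner (𝕜 := ℝ) ((hcG.tendsto zb).comp hz))
    refine tendsto_nhds_unique h1 (squeeze_zero_norm (fun k => (h k).stationary e) ?_)
    simpa using hε.mul_const ‖e‖

theorem tangent_limit (hφ : ContDiff ℝ 1 φ)
    (h : ∀ k, IsApproxStationary φ G g zb C (ε k) (z k) (y' k) (ys k) (α k) (w k) (η k))
    (hε : Tendsto ε atTop (𝓝 0)) {d : Eu n × Eu m}
    (hd : Tendsto (fun k => ‖z k - zb‖⁻¹ • (z k - zb)) atTop (𝓝 d)) :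
    Tendsto (fun k => ‖z k - zb‖⁻¹ • (y' k - zb.2)) atTop (𝓝 d.2) ∧
      (d.2, -fderiv ℝ φ zb d) ∈ tcone (gphN g) (zb.2, -φ zb) := by
  obtain ⟨ht, hz, -⟩ := tendsto_of_isApproxStationary h hε
  have hφd := (hφ.differentiable (by norm_num) zb).hasFDerivAt
  have hpos := fun k => (h k).pos
  have hy : Tendsto (fun k => ‖z k - zb‖⁻¹ • (y' k - zb.2)) atTop (𝓝 d.2) := by
    have h1 := ((continuous_snd.tendsto d).comp hd).sub
      (tendsto_inv_smul_zero hpos (fun k => (h k).dist_le) hε)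
    rw [sub_zero] at h1
    refine h1.congr fun k => ?_
    simp only [Function.comp, Prod.smul_snd, Prod.snd_sub, ← smul_sub]
    congr 1
    abel
  have hys : Tendsto (fun k => ‖z k - zb‖⁻¹ • (ys k + φ zb)) atTop (𝓝 (-fderiv ℝ φ zb d)) := by
    have h1 := (tendsto_inv_smul_zero hpos (fun k => (h k).residual_le) hε).sub
      (tendsto_slope_of_tendsto hφd hz hd)
    rw [zero_sub] at h1
    refine h1.congr fun k => ?_
    rw [← smul_sub]
    congr 1
    abel
  refine ⟨hy, fun k => ‖z k - zb‖, _, hpos, ht, hy.prodMk_nhds hys, fun k => ?_⟩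
  convert (h k).mem_gphN using 1
  ext1
  · simp [smul_inv_smul₀ (hpos k).ne']
  · simp [smul_inv_smul₀ (hpos k).ne']

end Limits

theorem fderiv_coord_apply {E : Type*} [NormedAddCommGroup E] [NormedSpace ℝ E] {q : ℕ}
    {g : E → Eu q} {y : E} (hg : DifferentiableAt ℝ g y) (i : Fin q) (d : E) :
    fderiv ℝ (fun y => g y i) y d = fderiv ℝ g y d i := by
  have h := (EuclideanSpace.proj (𝕜 := ℝ) i).hasFDerivAt.comp y hg.hasFDerivAt
  change fderiv ℝ (EuclideanSpace.proj (𝕜 := ℝ) i ∘ g) y d = _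
  rw [h.fderiv]
  rfl

theorem mem_ExtPts_of_forall {m q : ℕ} {g : Eu m → Eu q} {y ys : Eu m} {l : Eu q}
    (hg : DifferentiableAt ℝ g y) (hl : l ∈ Lam g y ys)
    (h : ∀ r : Eu q, (∀ i, l i = 0 → r i = 0) →
      ContinuousLinearMap.adjoint (fderiv ℝ g y) r = 0 → r = 0) : l ∈ ExtPts g y ys := by
  classical
  refine ⟨hl, Fintype.linearIndependent_iff.2 fun c hc i => ?_⟩
  set r : Eu q := WithLp.toLp 2 fun i => if hi : 0 < l i then c ⟨i, hi⟩ else 0 with hr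
  have hri : ∀ i : {i : Fin q // 0 < l i}, r i = c i := fun i => by simp [hr, i.2]
  have hr0 : ∀ i, ¬0 < l i → r i = 0 := fun i hi => by simp [hr, hi]
  have : r = 0 := by
    refine h r (fun i hi => hr0 i (by simp [hi])) (adjoint_eq_of_forall fun d => ?_)
    have h1 := DFunLike.congr_fun hc d
    simp only [sum_apply, smul_apply, smul_eq_mul, zero_apply, fderiv_coord_apply hg] at h1
    rw [inner_zero_left, inner_eq_sum, ← Finset.sum_filter_of_ne (p := fun i => 0 < l i),
      Finset.sum_subtype (p := fun i => 0 < l i) _ (by simp), ← h1]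
    · exact Finset.sum_congr rfl fun i _ => by rw [hri]
    · intro i _ hi
      by_contra hcon
      exact hi (by rw [hr0 i hcon, zero_mul])
  rw [← hri, this]
  rfl

/-- Limits of regular normals to the graph of the normal cone map along a convergent direction
carry an extreme directional multiplier satisfying the second-order inequality. -/
theorem exists_mem_dirLam_mem_ExtPts {m q : ℕ} {g : Eu m → Eu q} (hg : ContDiff ℝ 2 g)
    {yb ybs v α₀ w₀ : Eu m} {l₀ : Eu q} {κ δ : ℝ} (hκ : 0 < κ)
    (hnear : ∀ z, ‖z - yb‖ < δ →
      ∃ z', (∀ j, g z' j ≤ 0) ∧ ‖z' - z‖ ≤ κ * ∑ j, max (g z j) 0)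
    {y ys α w : ℕ → Eu m} {t : ℕ → ℝ} {l : ℕ → Eu q} (hyd : ∀ k, ‖y k - yb‖ < δ)
    (hp : ∀ k, (y k, ys k) ∈ gphN g)
    (hn : ∀ k, ∀ ε > (0 : ℝ), ∃ δ' > (0 : ℝ), ∀ p ∈ gphN g, ‖p - (y k, ys k)‖ < δ' →
      ⟪α k, p.1 - y k⟫ + ⟪w k, p.2 - ys k⟫ ≤ ε * ‖p - (y k, ys k)‖)
    (hl : ∀ k, l k ∈ Lam g (y k) (ys k))
    (hmin : ∀ k, ∀ l' ∈ Lam g (y k) (ys k), ∑ i, l k i ≤ ∑ i, l' i)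
    (ht : ∀ k, 0 < t k) (ht0 : Tendsto t atTop (𝓝 0)) (hy : Tendsto y atTop (𝓝 yb))
    (hys : Tendsto ys atTop (𝓝 ybs)) (hv : Tendsto (fun k => (t k)⁻¹ • (y k - yb)) atTop (𝓝 v))
    (hα : Tendsto α atTop (𝓝 α₀)) (hw : Tendsto w atTop (𝓝 w₀)) (hlim : Tendsto l atTop (𝓝 l₀)) :
    ∃ μ ∈ dirLam g yb ybs v, μ ∈ ExtPts g yb ybs ∧ (∀ i, 0 < μ i → fderiv ℝ g yb w₀ i = 0) ∧
      ⟪α₀, w₀⟫ + ⟪w₀, hessA g μ yb w₀⟫ ≤ 0 := by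
  have hg1 : ContDiff ℝ 1 g := hg.of_le (by norm_num)
  have hgd := hg.differentiable (by norm_num)
  have hl₀ : l₀ ∈ Lam g yb ybs := mem_Lam_of_tendsto hg1 (.of_forall hl) hy hys hlim
  have hreg := fun k => regular_normal_gphN hg hκ hnear (hyd k) (hp k) (hn k)
  have hli : ∀ i, Tendsto (fun k => l k i) atTop (𝓝 (l₀ i)) := fun i =>
    ((by fun_prop : Continuous fun x : Eu q => x i).tendsto l₀).comp hlim
  have hpos : ∀ i, l₀ i ≠ 0 → ∀ᶠ k in atTop, 0 < l k i := fun i hi =>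
    (hli i).eventually_const_lt ((hl₀.1 i).lt_of_ne' hi)
  have hgrad : ∀ i, l₀ i ≠ 0 → fderiv ℝ g yb w₀ i = 0 := fun i hi => by
    have hc := hg.continuous_fderiv (by norm_num)
    have h1 : Tendsto (fun k => fderiv ℝ g (y k) (w k)) atTop (𝓝 (fderiv ℝ g yb w₀)) :=
      ((by fun_prop : Continuous fun p : Eu m × Eu m => fderiv ℝ g p.1 p.2).tendsto
        (yb, w₀)).comp (hy.prodMk_nhds hw)
    have h2 := ((by fun_prop : Continuous fun x : Eu q => x i).tendsto _).comp h1
    exact tendsto_nhds_unique h2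
      (tendsto_const_nhds.congr' ((hpos i hi).mono fun k hk => ((hreg k).1 _ (hl k) i hk).symm))
  have hsecond : ⟪α₀, w₀⟫ + ⟪l₀, fderiv ℝ (fderiv ℝ g) yb w₀ w₀⟫ ≤ 0 := by
    have hc : Continuous (fderiv ℝ (fderiv ℝ g)) :=
      (hg.fderiv_right (m := 1) (by norm_num)).continuous_fderiv (by norm_num)
    have h1 : Tendsto (fun k => fderiv ℝ (fderiv ℝ g) (y k) (w k) (w k)) atTop
        (𝓝 (fderiv ℝ (fderiv ℝ g) yb w₀ w₀)) :=
      ((by fun_prop : Continuous fun p : Eu m × Eu m =>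
        fderiv ℝ (fderiv ℝ g) p.1 p.2 p.2).tendsto (yb, w₀)).comp (hy.prodMk_nhds hw)
    exact le_of_tendsto' ((hα.inner (𝕜 := ℝ) hw).add (hlim.inner (𝕜 := ℝ) h1))
      fun k => (hreg k).2 _ (hl k)
  set A : Eu q →ₗ[ℝ] Eu m := (ContinuousLinearMap.adjoint (fderiv ℝ g yb)).toLinearMap with hA
  set b : Eu q →ₗ[ℝ] ℝ :=
    (innerSL ℝ (fderiv ℝ (fderiv ℝ g) yb w₀ w₀)).toLinearMap with hb
  have hbl : ∀ r, b r = ⟪r, fderiv ℝ (fderiv ℝ g) yb w₀ w₀⟫ := fun r =>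
    real_inner_comm r (fderiv ℝ (fderiv ℝ g) yb w₀ w₀)
  obtain ⟨μ, hμ, hμsupp, hAμ, hbμ, hind⟩ := exists_support_minimal A b l₀ hl₀.1
    (fun r hr hsupp hAr => eq_zero_of_tendsto_minimal hg1 hκ hnear hyd (fun k => (hp k).1) hl hmin
      hy hlim hr hsupp hAr)
  have hμL : μ ∈ Lam g yb ybs :=
    ⟨hμ, hAμ.trans hl₀.2.1, fun i hi => hμsupp i (hl₀.2.2 i hi)⟩
  have hcomp : ∀ᶠ k in atTop, ⟪μ, g (y k)⟫ = 0 := by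
    have : ∀ᶠ k in atTop, ∀ i, l₀ i ≠ 0 → 0 < l k i :=
      eventually_all.2 fun i => by
        by_cases hi : l₀ i = 0
        · simp [hi]
        · exact (hpos i hi).mono fun k hk _ => hk
    filter_upwards [this] with k hk
    rw [inner_eq_sum]
    refine Finset.sum_eq_zero fun i _ => ?_
    by_cases hi : l₀ i = 0
    · rw [hμsupp i hi, zero_mul]
    · have : g (y k) i = 0 := by
        by_contra hcon
        exact (hk i hi).ne' ((hl k).2.2 i hcon)
      rw [this, mul_zero]
  refine ⟨μ, ⟨hμL, fun l' hl' => ?_⟩, mem_ExtPts_of_forall (hgd yb) hμL hind,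
    fun i hi => hgrad i fun h => hi.ne' (hμsupp i h), ?_⟩
  · rw [inner_hessA hg, inner_hessA hg]
    exact inner_fderiv_fderiv_le_of_tendsto hg hμL hl' (fun k => (hp k).1) ht ht0 hv hcomp
  · rw [inner_hessA hg]
    rw [hbl, hbl] at hbμ
    linarith

theorem fderiv_prodMk_left_apply {n m k : ℕ} {F : Eu n × Eu m → Eu k} (hF : Differentiable ℝ F)
    (x : Eu n) (y : Eu m) (d : Eu n) :
    fderiv ℝ (fun x => F (x, y)) x d = fderiv ℝ F (x, y) (d, 0) := by
  have h := (hF (x, y)).hasFDerivAt.comp x (hasFDerivAt_prodMk_left (𝕜 := ℝ) x y)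
  change fderiv ℝ (F ∘ fun x => (x, y)) x d = _
  rw [h.fderiv]
  rfl

theorem fderiv_prodMk_right_apply {n m k : ℕ} {F : Eu n × Eu m → Eu k} (hF : Differentiable ℝ F)
    (x : Eu n) (y : Eu m) (d : Eu m) :
    fderiv ℝ (fun y => F (x, y)) y d = fderiv ℝ F (x, y) (0, d) := by
  have h := (hF (x, y)).hasFDerivAt.comp y (hasFDerivAt_prodMk_right (𝕜 := ℝ) x y)
  change fderiv ℝ (F ∘ fun y => (x, y)) y d = _
  rw [h.fderiv]
  rfl

/-- If the solution map of the equilibrium system fails to be metrically subregular, then there is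
a critical direction carrying nontrivial limiting dual data. -/
theorem exists_limiting_multipliers {n m p q : ℕ} {φ : Eu n × Eu m → Eu m}
    {G : Eu n × Eu m → Eu p} {g : Eu m → Eu q}
    (hφ : ContDiff ℝ 1 φ) (hG : ContDiff ℝ 1 G) (hg : ContDiff ℝ 2 g) {zb : Eu n × Eu m}
    (hzb : zb ∈ mpecSol φ G g) (hMSCQg : MSCQlow g zb.2)
    (hMSCQG : msr (fun z : Eu n × Eu m => {w : Eu p | ∀ j, G z j - w j ≤ 0}) zb 0)
    (hnot : ¬msr (fun z : Eu n × Eu m =>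
        {w : Eu m × Eu p |
          (z.2 ∈ Gam g ∧ w.1 - φ z ∈ rnc (Gam g) z.2) ∧ ∀ j, G z j - w.2 j ≤ 0}) zb (0, 0)) :
    ∃ (d : Eu n × Eu m) (α₀ w₀ : Eu m) (μ : Eu q) (η₀ : Eu p),
      ‖d‖ = 1 ∧ ‖α₀‖ ^ 2 + ‖w₀‖ ^ 2 = 1 ∧
      (∀ j, G zb j = 0 → fderiv ℝ G zb d j ≤ 0) ∧
      (d.2, -fderiv ℝ φ zb d) ∈ tcone (gphN g) (zb.2, -φ zb) ∧
      μ ∈ dirLam g zb.2 (-φ zb) d.2 ∧ μ ∈ ExtPts g zb.2 (-φ zb) ∧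
      (∀ i, 0 < μ i → fderiv ℝ g zb.2 w₀ i = 0) ∧
      ⟪α₀, w₀⟫ + ⟪w₀, hessA g μ zb.2 w₀⟫ ≤ 0 ∧
      (∀ j, 0 ≤ η₀ j) ∧ (∀ j, G zb j ≠ 0 → η₀ j = 0) ∧ ⟪η₀, fderiv ℝ G zb d⟫ = 0 ∧
      ∀ e, ⟪α₀, e.2⟫ - ⟪w₀, fderiv ℝ φ zb e⟫ + ⟪η₀, fderiv ℝ G zb e⟫ = 0 := by
  obtain ⟨κ, hκ, δ, hδ, hnear⟩ := exists_near_feasible hMSCQG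
  obtain ⟨κ', hκ', δ', hδ', hnear'⟩ := exists_near_feasible hMSCQg
  have hg1 : ContDiff ℝ 1 g := hg.of_le (by norm_num)
  have hgd : Differentiable ℝ g := hg1.differentiable (by norm_num)
  have happrox : ∀ ε > (0 : ℝ), ε ≤ 1 → ∃ z y' ys α w η, IsApproxStationary φ G g zb
      (κ * (‖fderiv ℝ φ zb‖ + 3)) ε z y' ys α w η := fun ε hε hε1 =>
    exists_isApproxStationary hφ hG hg1 hzb hκ hδ hnear hκ' hδ' hnear' hnot hε hε1
  obtain ⟨ε, z, y', ys, α, w, η, l, d, α₀, w₀, η₀, l₀, hε, hst, hyd, hl, hmin, hd, hα, hw, hη,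
    hlim⟩ := exists_limit_of_isApproxStationary hφ.continuous hgd hκ' hδ' hnear' happrox
  obtain ⟨hdn, hunit, ha, hη0, hηc, hηd, hstat⟩ := first_order_limit hφ hG hst hε hd hα hw hη
  obtain ⟨hv, hb⟩ := tangent_limit hφ hst hε hd
  obtain ⟨ht, -, hy⟩ := tendsto_of_isApproxStationary hst hε
  have hys := tendsto_normal_of_isApproxStationary hφ.continuous hst hε
  obtain ⟨μ, hμd, hμe, hμg, hμ2⟩ := exists_mem_dirLam_mem_ExtPts hg hκ' hnear' hyd
    (fun k => (hst k).mem_gphN) (fun k => (hst k).normal) hl hmin (fun k => (hst k).pos) ht hy hys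
    hv hα hw hlim
  exact ⟨d, α₀, w₀, μ, η₀, hdn, hunit, ha, hb, hμd, hμe, hμg, hμ2, hη0, hηc, hηd, hstat⟩

/-- verifiable sufficient condition for MSCQ for the MPEC constraint
system `0 ∈ φ(x,y) + N̂_Γ(y), G(x,y) ≤ 0`.  Under MSCQ for the lower-level system
`g(y) ≤ 0` at `ȳ` and for the upper-level system `G(x,y) ≤ 0` at `(x̄, ȳ)`, condition
(ii) on `∇G`, and the non-existence condition (iii), the set-valued map
`M_MPEC(x,y) = (φ(x,y) + N̂_Γ(y)) × (G(x,y) − ℝ^p₋)` is metrically subregular at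
`((x̄, ȳ), 0)`. -/
theorem stmt_18 {n m p q : ℕ}
    (φ : Eu n × Eu m → Eu m) (G : Eu n × Eu m → Eu p) (g : Eu m → Eu q)
    (hφ : ContDiff ℝ 1 φ) (hG : ContDiff ℝ 1 G) (hg : ContDiff ℝ 2 g)
    (xb : Eu n) (yb : Eu m)
    -- feasibility: 0 ∈ φ(x̄,ȳ) + N̂_Γ(ȳ) and G(x̄,ȳ) ≤ 0
    (hyb : yb ∈ Gam g) (hGE : -φ (xb, yb) ∈ rnc (Gam g) yb)
    (hGfeas : ∀ j, G (xb, yb) j ≤ 0)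
    -- (i) MSCQ for the lower-level system g(y) ≤ 0 at ȳ
    (hMSCQg : MSCQlow g yb)
    -- (i) MSCQ for the upper-level system G(x,y) ≤ 0 at (x̄,ȳ)
    (hMSCQG : msr (fun z : Eu n × Eu m => {w : Eu p | ∀ j, G z j - w j ≤ 0}) (xb, yb) 0)
    -- (ii)
    (hii : ∀ η : Eu p, (∀ j, 0 ≤ η j) → (∀ j, G (xb, yb) j < 0 → η j = 0) →
      ContinuousLinearMap.adjoint (fderiv ℝ (fun x => G (x, yb)) xb) η = 0 →
      ContinuousLinearMap.adjoint (fderiv ℝ (fun y => G (xb, y)) yb) η = 0)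
    -- (iii)
    (hiii : ¬ ∃ (u : Eu n) (v : Eu m) (l : Eu q) (η : Eu p) (w : Eu m),
      (u, v) ≠ (0, 0) ∧
      l ∈ dirLam g yb (-φ (xb, yb)) v ∧ l ∈ ExtPts g yb (-φ (xb, yb)) ∧
      (∀ j, 0 ≤ η j) ∧ w ≠ 0 ∧
      -- (a)
      (∀ j, G (xb, yb) j = 0 → fderiv ℝ G (xb, yb) (u, v) j ≤ 0) ∧
      -- (b)
      (v, -(fderiv ℝ φ (xb, yb) (u, v))) ∈ tcone (gphN g) (yb, -φ (xb, yb)) ∧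
      -- (c)
      (-(ContinuousLinearMap.adjoint (fderiv ℝ (fun x => φ (x, yb)) xb) w) +
        ContinuousLinearMap.adjoint (fderiv ℝ (fun x => G (x, yb)) xb) η = 0) ∧
      (∀ j, G (xb, yb) j < 0 → η j = 0) ∧
      ⟪η, fderiv ℝ G (xb, yb) (u, v)⟫ = 0 ∧
      -- (d)
      (∀ i, 0 < l i → fderiv ℝ (fun y => g y i) yb w = 0) ∧
      ⟪w, fderiv ℝ (fun y => φ (xb, y)) yb w⟫ + ⟪w, hessA g l yb w⟫ -
        ⟪η, fderiv ℝ (fun y => G (xb, y)) yb w⟫ ≤ 0) :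
    msr (fun z : Eu n × Eu m =>
        {w : Eu m × Eu p |
          (z.2 ∈ Gam g ∧ w.1 - φ z ∈ rnc (Gam g) z.2) ∧ ∀ j, G z j - w.2 j ≤ 0})
      (xb, yb) (0, 0) := by
  by_contra hnot
  have hzb : (xb, yb) ∈ mpecSol φ G g := ⟨⟨hyb, hGE⟩, hGfeas⟩
  have hφd : Differentiable ℝ φ := hφ.differentiable (by norm_num)
  have hGd : Differentiable ℝ G := hG.differentiable (by norm_num)
  have hgd : Differentiable ℝ g := hg.differentiable (by norm_num)
  obtain ⟨⟨u, v⟩, α₀, w₀, μ, η₀, hdn, hunit, ha, hb, hμd, hμe, hμg, hμ2, hη0, hηc, hηd, hstat⟩ :=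
    exists_limiting_multipliers hφ hG hg (zb := (xb, yb)) hzb hMSCQg hMSCQG hnot
  have hηn : ∀ j, G (xb, yb) j < 0 → η₀ j = 0 := fun j hj => hηc j hj.ne
  have hc : -(ContinuousLinearMap.adjoint (fderiv ℝ (fun x => φ (x, yb)) xb) w₀) +
      ContinuousLinearMap.adjoint (fderiv ℝ (fun x => G (x, yb)) xb) η₀ = 0 := by
    refine ext_inner_right ℝ fun d => ?_
    have h1 := hstat (d, 0)
    rw [inner_add_left, inner_neg_left, inner_adjoint_apply, inner_adjoint_apply,
      fderiv_prodMk_left_apply hφd, fderiv_prodMk_left_apply hGd, inner_zero_left]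
    rw [inner_zero_right] at h1
    linarith
  have hstaty : ∀ d, ⟪α₀, d⟫ - ⟪w₀, fderiv ℝ (fun y => φ (xb, y)) yb d⟫ +
      ⟪η₀, fderiv ℝ (fun y => G (xb, y)) yb d⟫ = 0 := fun d => by
    rw [fderiv_prodMk_right_apply hφd, fderiv_prodMk_right_apply hGd]
    exact hstat (0, d)
  have hw0 : w₀ ≠ 0 := fun h0 => by
    rw [h0, map_zero, neg_zero, zero_add] at hc
    have h1 := hii η₀ hη0 hηn hc
    have h2 := hstaty α₀
    rw [h0, inner_zero_left, ← inner_adjoint_apply, h1, inner_zero_left,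
      real_inner_self_eq_norm_sq] at h2
    rw [h0, norm_zero] at hunit
    linarith
  have hμg' : ∀ i, 0 < μ i → fderiv ℝ (fun y => g y i) yb w₀ = 0 := fun i hi =>
    (fderiv_coord_apply (hgd yb) i w₀).trans (hμg i hi)
  have hd0 : (u, v) ≠ (0, 0) := fun h => by
    rw [h] at hdn
    simp at hdn
  have hcurv : ⟪w₀, fderiv ℝ (fun y => φ (xb, y)) yb w₀⟫ + ⟪w₀, hessA g μ yb w₀⟫ -
      ⟪η₀, fderiv ℝ (fun y => G (xb, y)) yb w₀⟫ ≤ 0 := by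
    have h1 : ⟪α₀, w₀⟫ + ⟪w₀, hessA g μ yb w₀⟫ ≤ 0 := hμ2
    linarith [hstaty w₀]
  exact hiii ⟨u, v, μ, η₀, w₀, hd0, hμd, hμe, hη0, hw0, ha, hb, hc, hηn, hηd, hμg', hcurv⟩
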